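/- arXiv:1909.13152 — 6 statements merged into one kernel-verified Lean document; each statement's English description precedes it below -/
import Mathlib

section
/- Let ρ be a pure tripartite qudit state on ℂ^d ⊗ ℂ^d ⊗ ℂ^d. Then the isotropic strengths of its two-party reduced states satisfy s_iso^{AB} = (d(1+‖c‖²) − 1 − ‖a‖² − ‖b‖²)/(d²−1), s_iso^{BC} = (d(1+‖a‖²) − 1 − ‖b‖² − ‖c‖²)/(d²−1), and s_iso^{AC} = (d(1+‖b‖²) − 1 − ‖a‖² − ‖c‖²)/(d²−1). -/
open Matrix ComplexOrder

namespace SpinCorr3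

variable {d : ℕ}

/-- Tensor (Kronecker) product of three `d × d` matrices, acting on `ℂ^d ⊗ ℂ^d ⊗ ℂ^d`. -/
noncomputable def kron3 (A B C : Matrix (Fin d) (Fin d) ℂ) :
    Matrix (Fin d × Fin d × Fin d) (Fin d × Fin d × Fin d) ℂ :=
  Matrix.of fun p q => A p.1 q.1 * B p.2.1 q.2.1 * C p.2.2 q.2.2

variable (lam : Fin (d ^ 2 - 1) → Matrix (Fin d) (Fin d) ℂ)
variable (ρ : Matrix (Fin d × Fin d × Fin d) (Fin d × Fin d × Fin d) ℂ)

/-- `‖a‖²`, the squared Euclidean norm of the Bloch vector of party A. -/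
noncomputable def aSq : ℝ := ∑ i, ‖(ρ * kron3 (lam i) 1 1).trace‖ ^ 2

/-- `‖b‖²`. -/
noncomputable def bSq : ℝ := ∑ j, ‖(ρ * kron3 1 (lam j) 1).trace‖ ^ 2

/-- `‖c‖²`. -/
noncomputable def cSq : ℝ := ∑ l, ‖(ρ * kron3 1 1 (lam l)).trace‖ ^ 2

/-- `‖R^{AB}‖²`, squared Frobenius norm of the spin correlation matrix of parties A,B. -/
noncomputable def RABsq : ℝ := ∑ i, ∑ j, ‖(ρ * kron3 (lam i) (lam j) 1).trace‖ ^ 2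

/-- `‖R^{BC}‖²`. -/
noncomputable def RBCsq : ℝ := ∑ j, ∑ l, ‖(ρ * kron3 1 (lam j) (lam l)).trace‖ ^ 2

/-- `‖R^{AC}‖²`. -/
noncomputable def RACsq : ℝ := ∑ i, ∑ l, ‖(ρ * kron3 (lam i) 1 (lam l)).trace‖ ^ 2

/-- `‖R^{ABC}‖²`, squared Euclidean norm of the tripartite correlation tensor. -/
noncomputable def RABCsq : ℝ := ∑ i, ∑ j, ∑ l, ‖(ρ * kron3 (lam i) (lam j) (lam l)).trace‖ ^ 2

/-- Isotropic strength `s_iso^{AB} = ‖R^{AB}‖²/(d²-1)`. -/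
noncomputable def sAB : ℝ := RABsq lam ρ / ((d : ℝ) ^ 2 - 1)

/-- `s_iso^{BC}`. -/
noncomputable def sBC : ℝ := RBCsq lam ρ / ((d : ℝ) ^ 2 - 1)

/-- `s_iso^{AC}`. -/
noncomputable def sAC : ℝ := RACsq lam ρ / ((d : ℝ) ^ 2 - 1)

open scoped Kronecker

/-- A family of matrices satisfying the completeness relation `∑ i, M i ⊗ M i = c • SWAP`. -/
def SwapComplete {ι n : Type*} [Fintype ι] [DecidableEq n] (M : ι → Matrix n n ℂ) (c : ℂ) : Prop :=
  ∀ a b a' b', ∑ i, M i a b * M i a' b' = if a = b' ∧ b = a' then c else 0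

lemma SwapComplete.kronecker {ι κ m n : Type*} [Fintype ι] [Fintype κ] [DecidableEq m]
    [DecidableEq n] {M : ι → Matrix m m ℂ} {N : κ → Matrix n n ℂ} {c c' : ℂ}
    (hM : SwapComplete M c) (hN : SwapComplete N c') :
    SwapComplete (fun x : ι × κ => M x.1 ⊗ₖ N x.2) (c * c') := by
  rintro ⟨a, s⟩ ⟨b, t⟩ ⟨a', s'⟩ ⟨b', t'⟩
  have h : ∀ x : ι × κ, (M x.1 ⊗ₖ N x.2) (a, s) (b, t) *
      (M x.1 ⊗ₖ N x.2) (a', s') (b', t') =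
      (M x.1 a b * M x.1 a' b') * (N x.2 s t * N x.2 s' t') := fun x => by
    simp only [kroneckerMap_apply]; ring
  simp only [h]
  rw [Fintype.sum_prod_type]
  simp only [← Finset.mul_sum, ← Finset.sum_mul, hM a b a' b', hN s t s' t', Prod.mk.injEq]
  by_cases h1 : a = b' <;> by_cases h2 : b = a' <;> by_cases h3 : s = t' <;>
    by_cases h4 : t = s' <;> simp [h1, h2, h3, h4]

lemma SwapComplete.sum_trace_mul_sq {ι n : Type*} [Fintype ι] [Fintype n] [DecidableEq n]
    {M : ι → Matrix n n ℂ} {c : ℂ} (hM : SwapComplete M c) (X : Matrix n n ℂ) :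
    ∑ i, (X * M i).trace ^ 2 = c * (X * X).trace := by
  have h : ∀ i, (X * M i).trace ^ 2 =
      ∑ a, ∑ b, ∑ a', ∑ b', X a b * X a' b' * (M i b a * M i b' a') := fun i => by
    simp only [sq, trace, diag_apply, mul_apply, Finset.sum_mul, Finset.mul_sum]
    refine Finset.sum_congr rfl fun a _ => Finset.sum_congr rfl fun b _ =>
      Finset.sum_congr rfl fun a' _ => Finset.sum_congr rfl fun b' _ => by ring
  simp only [h]
  rw [Finset.sum_comm]
  simp only [trace, diag_apply, mul_apply, Finset.mul_sum]
  refine Finset.sum_congr rfl fun a _ => ?_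
  rw [Finset.sum_comm]
  refine Finset.sum_congr rfl fun b _ => ?_
  rw [Finset.sum_comm]
  have h' : ∀ a' : n, ∑ i, ∑ b', X a b * X a' b' * (M i b a * M i b' a') =
      if b = a' then c * (X a b * X b a) else 0 := fun a' => by
    rw [Finset.sum_comm]
    simp only [← Finset.mul_sum, fun b' => hM b a b' a']
    rw [Finset.sum_eq_single a]
    · by_cases hb : b = a'
      · subst hb
        simp [mul_comm]
      · simp [hb]
    · intro b' _ hb'
      simp [Ne.symm hb']
    · simp
  simp [h']

/-- A family of matrices extended by the identity matrix. -/
def withOne {ι n : Type*} [DecidableEq n] (lam : ι → Matrix n n ℂ) (o : Option ι) :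
    Matrix n n ℂ :=
  o.elim 1 lam

lemma swapComplete_of_orthogonal {ι n : Type*} [Fintype ι] [DecidableEq ι] [Fintype n]
    [DecidableEq n] (M : ι → Matrix n n ℂ) (hcard : Fintype.card ι = Fintype.card (n × n))
    {c : ℂ} (hc : c ≠ 0) (horth : ∀ i j, (M i * M j).trace = if i = j then c else 0) :
    SwapComplete M c := by
  intro a b a' b'
  let P : Matrix ι (n × n) ℂ := of fun i p => c⁻¹ * M i p.1 p.2
  let Q : Matrix (n × n) ι ℂ := of fun p i => M i p.2 p.1
  have hPQ : P * Q = 1 := by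
    ext i j
    have h := horth i j
    simp only [trace, diag_apply, mul_apply] at h
    simp only [P, Q, mul_apply, of_apply, Fintype.sum_prod_type, mul_assoc, ← Finset.mul_sum, h,
      one_apply]
    by_cases hij : i = j <;> simp [hij, hc]
  have hQP : Q * P = 1 := (mul_eq_one_comm_of_card_eq _ _ _ hcard).1 hPQ
  have h := congr_fun (congr_fun hQP (b, a)) (a', b')
  simp only [P, Q, mul_apply, of_apply, one_apply, Prod.mk.injEq, mul_left_comm _ c⁻¹,
    ← Finset.mul_sum] at h
  rw [inv_mul_eq_iff_eq_mul₀ hc] at h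
  rw [h]
  by_cases h1 : a = b' <;> by_cases h2 : b = a' <;> simp [h1, h2]

lemma swapComplete_withOne {d : ℕ} (hd : 2 ≤ d) {lam : Fin (d ^ 2 - 1) → Matrix (Fin d) (Fin d) ℂ}
    (htr0 : ∀ i, (lam i).trace = 0)
    (horth : ∀ i j, (lam i * lam j).trace = if i = j then (d : ℂ) else 0) :
    SwapComplete (withOne lam) d := by
  refine swapComplete_of_orthogonal _ ?_ (by norm_cast; omega) ?_
  · have : 1 ≤ d ^ 2 := Nat.one_le_pow _ _ (by omega)
    simp only [Fintype.card_option, Fintype.card_fin, Fintype.card_prod]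
    rw [Nat.sub_add_cancel this, sq]
  · rintro (_ | i) (_ | j) <;> simp [withOne, htr0, horth]

/-- A pure state has vanishing `2 × 2` minors. -/
lemma pure_apply_mul_apply {n : Type*} [Fintype n] {ρ : Matrix n n ℂ}
    (hρ : ρ.IsHermitian) (htr : ρ.trace = 1) (hpure : ρ * ρ = ρ) (p q r s : n) :
    ρ p q * ρ r s = ρ p s * ρ r q := by
  obtain ⟨k, hk⟩ : ∃ k, ρ k k ≠ 0 := by
    by_contra! h
    simp [trace, h] at htr
  set t := ρ k k
  let V : Matrix n n ℂ := vecMulVec (fun i => ρ i k) (fun j => ρ k j)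
  have hsum : ∀ i j, ∑ l, ρ i l * ρ l j = ρ i j := fun i j => by
    rw [← mul_apply, hpure]
  have hρV : ρ * V = V := by
    ext i j
    simp only [V, mul_apply, vecMulVec_apply, ← mul_assoc, ← Finset.sum_mul, hsum]
  have hVρ : V * ρ = V := by
    ext i j
    simp only [V, mul_apply, vecMulVec_apply, mul_assoc, ← Finset.mul_sum, hsum]
  have hVV : V * V = t • V := by
    ext i j
    have h : ∀ l, ρ i k * ρ k l * (ρ l k * ρ k j) = ρ i k * ρ k j * (ρ k l * ρ l k) :=
      fun l => by ring
    simp only [V, mul_apply, vecMulVec_apply, h, ← Finset.mul_sum, hsum, Matrix.smul_apply, smul_eq_mul]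
    exact mul_comm _ _
  have htrV : V.trace = t := by
    simp only [V, trace, diag_apply, vecMulVec_apply, mul_comm (ρ _ k), hsum, t]
  have hstar : ∀ i j, star (ρ i j) = ρ j i := fun i j => hρ.apply j i
  have hVH : Vᴴ = V := by
    ext i j
    simp only [V, conjTranspose_apply, vecMulVec_apply, star_mul', hstar, mul_comm]
  have hσ : ρ - t⁻¹ • V = 0 := by
    rw [← trace_conjTranspose_mul_self_eq_zero_iff]
    have h1 : (ρ - t⁻¹ • V)ᴴ = ρ - t⁻¹ • V := by
      rw [conjTranspose_sub, conjTranspose_smul, hρ.eq, hVH, star_inv₀, hstar]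
    rw [h1]
    simp only [sub_mul, mul_sub, Matrix.smul_mul, Matrix.mul_smul, hρV, hVρ, hVV, hpure, smul_smul]
    simp [htr, htrV, hk]
  have hentry : ∀ i j, ρ i j = t⁻¹ * (ρ i k * ρ k j) := fun i j => by
    have := congr_fun (congr_fun (sub_eq_zero.1 hσ) i) j
    simpa [V, vecMulVec_apply] using this
  rw [hentry p q, hentry r s, hentry p s, hentry r q]
  ring

/-- Partial trace over the second factor. -/
def traceSnd {m n : Type*} [Fintype n] (X : Matrix (m × n) (m × n) ℂ) : Matrix m m ℂ :=
  of fun a a' => ∑ c, X (a, c) (a', c)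

/-- Partial trace over the first factor. -/
def traceFst {m n : Type*} [Fintype m] (X : Matrix (m × n) (m × n) ℂ) : Matrix n n ℂ :=
  of fun c c' => ∑ a, X (a, c) (a, c')

section PartialTrace

variable {m n : Type*} [Fintype m] [Fintype n]

lemma trace_traceSnd_mul [DecidableEq n] (X : Matrix (m × n) (m × n) ℂ) (K : Matrix m m ℂ) :
    (traceSnd X * K).trace = (X * (K ⊗ₖ (1 : Matrix n n ℂ))).trace := by
  simp only [trace, diag_apply, mul_apply, traceSnd, of_apply, Fintype.sum_prod_type,
    kroneckerMap_apply, one_apply, Finset.sum_mul]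
  refine Finset.sum_congr rfl fun a _ => ?_
  rw [Finset.sum_comm]
  simp

lemma trace_traceFst_mul [DecidableEq m] (X : Matrix (m × n) (m × n) ℂ) (K : Matrix n n ℂ) :
    (traceFst X * K).trace = (X * ((1 : Matrix m m ℂ) ⊗ₖ K)).trace := by
  simp only [trace, diag_apply, mul_apply, traceFst, of_apply, Fintype.sum_prod_type_right,
    kroneckerMap_apply, one_apply, Finset.sum_mul]
  refine Finset.sum_congr rfl fun a _ => ?_
  rw [Finset.sum_comm]
  simp

/-- The two reduced states of a pure bipartite state have the same purity. -/
lemma trace_traceSnd_sq_eq {X : Matrix (m × n) (m × n) ℂ}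
    (hX : ∀ p q r s, X p q * X r s = X p s * X r q) :
    (traceSnd X * traceSnd X).trace = (traceFst X * traceFst X).trace := by
  simp only [trace, diag_apply, mul_apply, traceSnd, traceFst, of_apply, Finset.sum_mul,
    Finset.mul_sum]
  calc
    _ = ∑ a, ∑ a', ∑ c, ∑ c', X (a, c) (a, c') * X (a', c') (a', c) := by
      refine Finset.sum_congr rfl fun a _ => Finset.sum_congr rfl fun a' _ => ?_
      rw [Finset.sum_comm]
      exact Finset.sum_congr rfl fun c _ => Finset.sum_congr rfl fun c' _ => hX _ _ _ _
    _ = ∑ x : m × m, ∑ y : n × n,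
          X (x.1, y.1) (x.1, y.2) * X (x.2, y.2) (x.2, y.1) := by
      simp only [Fintype.sum_prod_type]
    _ = ∑ y : n × n, ∑ x : m × m,
          X (x.1, y.1) (x.1, y.2) * X (x.2, y.2) (x.2, y.1) := Finset.sum_comm
    _ = _ := by
      simp only [Fintype.sum_prod_type]
      refine Finset.sum_congr rfl fun c _ => Finset.sum_congr rfl fun c' _ => ?_
      exact Finset.sum_comm

end PartialTrace

/-- Bloch-vector form of the purity identity for a pure state on `(ℂ^d ⊗ ℂ^d) ⊗ ℂ^d`, in terms
of its correlation function `T A B C = tr (ρ (A ⊗ B ⊗ C))`. -/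
lemma sum_sq_correlation_eq {ι n : Type*} [Fintype ι] [Fintype n] [DecidableEq n]
    {lam : ι → Matrix n n ℂ} {c : ℂ} (hlam : SwapComplete (withOne lam) c)
    {X : Matrix ((n × n) × n) ((n × n) × n) ℂ}
    (hX : ∀ p q r s, X p q * X r s = X p s * X r q) (htr : X.trace = 1)
    {T : Matrix n n ℂ → Matrix n n ℂ → Matrix n n ℂ → ℂ}
    (hT : ∀ A B C, T A B C =
      (X * ((A ⊗ₖ B) ⊗ₖ C)).trace) :
    ∑ i, ∑ j, T (lam i) (lam j) 1 ^ 2 =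
      c * (1 + ∑ l, T 1 1 (lam l) ^ 2) - 1 - ∑ i, T (lam i) 1 1 ^ 2 - ∑ j, T 1 (lam j) 1 ^ 2 := by
  have h1 := (hlam.kronecker hlam).sum_trace_mul_sq (traceSnd X)
  rw [trace_traceSnd_sq_eq hX, mul_assoc, ← hlam.sum_trace_mul_sq (traceFst X)] at h1
  have hone : (1 : Matrix n n ℂ) ⊗ₖ (1 : Matrix n n ℂ) = 1 := one_kronecker_one
  have hT1 : T 1 1 1 = 1 := by
    rw [hT, one_kronecker_one, one_kronecker_one, mul_one, htr]
  simp only [trace_traceSnd_mul, trace_traceFst_mul, ← hone, ← hT, Fintype.sum_prod_type,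
    Fintype.sum_option, withOne, Option.elim, hT1, Finset.sum_add_distrib] at h1
  linear_combination h1

lemma star_trace_mul_kron3 {d : ℕ} {ρ : Matrix (Fin d × Fin d × Fin d) (Fin d × Fin d × Fin d) ℂ}
    (hρ : ρ.IsHermitian) {A B C : Matrix (Fin d) (Fin d) ℂ} (hA : A.IsHermitian)
    (hB : B.IsHermitian) (hC : C.IsHermitian) :
    star (ρ * kron3 A B C).trace = (ρ * kron3 A B C).trace := by
  have h : (kron3 A B C)ᴴ = kron3 A B C := by
    ext p q
    simp only [conjTranspose_apply, kron3, of_apply, star_mul', hA.apply, hB.apply, hC.apply]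
  rw [← trace_conjTranspose, conjTranspose_mul, h, hρ.eq, trace_mul_comm]

lemma ofReal_norm_sq_of_star_eq {z : ℂ} (hz : star z = z) : ((‖z‖ ^ 2 : ℝ) : ℂ) = z ^ 2 := by
  rw [← Complex.normSq_eq_norm_sq, ← Complex.mul_conj, sq]
  exact congrArg (z * ·) hz

lemma trace_mul_eq_trace_submatrix_mul {m n : Type*} [Fintype m] [Fintype n] (e : m ≃ n)
    (X K : Matrix n n ℂ) :
    (X * K).trace = (X.submatrix e e * K.submatrix e e).trace := by
  rw [submatrix_mul_equiv]
  exact (Fintype.sum_equiv e _ _ fun _ => rfl).symm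

/-- The regrouping `((b, c), a) ↦ (a, b, c)`. -/
def equivBCA (α : Type*) : (α × α) × α ≃ α × α × α := Equiv.prodComm _ _

/-- The regrouping `((a, c), b) ↦ (a, b, c)`. -/
def equivACB (α : Type*) : (α × α) × α ≃ α × α × α where
  toFun x := (x.1.1, x.2, x.1.2)
  invFun x := ((x.1, x.2.2), x.2.1)

/-- For a pure tripartite qudit state the isotropic strengths of the two-party reduced
states are expressed through the Bloch vector norms (Eq. (7) of the paper). -/
theorem isotropic_strengths_of_pure_tripartite (d : ℕ) (hd : 2 ≤ d)
    (lam : Fin (d ^ 2 - 1) → Matrix (Fin d) (Fin d) ℂ)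
    (hherm : ∀ i, (lam i).IsHermitian)
    (htr0 : ∀ i, (lam i).trace = 0)
    (horth : ∀ i j, (lam i * lam j).trace = if i = j then (d : ℂ) else 0)
    (ρ : Matrix (Fin d × Fin d × Fin d) (Fin d × Fin d × Fin d) ℂ)
    (hpsd : ρ.PosSemidef) (htr1 : ρ.trace = 1) (hpure : ρ * ρ = ρ) :
    sAB lam ρ = ((d : ℝ) * (1 + cSq lam ρ) - 1 - aSq lam ρ - bSq lam ρ) / ((d : ℝ) ^ 2 - 1) ∧
    sBC lam ρ = ((d : ℝ) * (1 + aSq lam ρ) - 1 - bSq lam ρ - cSq lam ρ) / ((d : ℝ) ^ 2 - 1) ∧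
    sAC lam ρ = ((d : ℝ) * (1 + bSq lam ρ) - 1 - aSq lam ρ - cSq lam ρ) / ((d : ℝ) ^ 2 - 1) := by
  have hlam := swapComplete_withOne hd htr0 horth
  have hρ := hpsd.isHermitian
  have hrank := pure_apply_mul_apply hρ htr1 hpure
  have h1 : (1 : Matrix (Fin d) (Fin d) ℂ).IsHermitian := isHermitian_one
  have hreal : ∀ {A B C : Matrix (Fin d) (Fin d) ℂ}, A.IsHermitian → B.IsHermitian →
      C.IsHermitian → ((‖(ρ * kron3 A B C).trace‖ : ℝ) : ℂ) ^ 2 = (ρ * kron3 A B C).trace ^ 2 :=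
    fun hA hB hC => by
      exact_mod_cast ofReal_norm_sq_of_star_eq (star_trace_mul_kron3 hρ hA hB hC)
  have htr : ∀ e : (Fin d × Fin d) × Fin d ≃ Fin d × Fin d × Fin d,
      (ρ.submatrix e e).trace = 1 := fun e => by
    rw [← htr1]
    exact Fintype.sum_equiv e _ _ fun _ => rfl
  refine ⟨congrArg (· / _) ?_, congrArg (· / _) ?_, congrArg (· / _) ?_⟩ <;>
    apply Complex.ofReal_injective <;>
    simp only [RABsq, RBCsq, RACsq, aSq, bSq, cSq, Complex.ofReal_sum, Complex.ofReal_sub,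
      Complex.ofReal_mul, Complex.ofReal_add, Complex.ofReal_one, Complex.ofReal_natCast,
      Complex.ofReal_pow, hreal (hherm _) (hherm _) h1, hreal (hherm _) h1 (hherm _),
      hreal h1 (hherm _) (hherm _), hreal (hherm _) h1 h1, hreal h1 (hherm _) h1,
      hreal h1 h1 (hherm _)]
  · let e := Equiv.prodAssoc (Fin d) (Fin d) (Fin d)
    exact sum_sq_correlation_eq hlam (X := ρ.submatrix e e) (fun _ _ _ _ => hrank _ _ _ _)
      (htr e) (T := fun A B C => (ρ * kron3 A B C).trace)
      fun A B C => trace_mul_eq_trace_submatrix_mul e _ _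
  · let e := equivBCA (Fin d)
    refine sum_sq_correlation_eq hlam (X := ρ.submatrix e e) (fun _ _ _ _ => hrank _ _ _ _)
      (htr e) (T := fun B C A => (ρ * kron3 A B C).trace) fun B C A => ?_
    rw [trace_mul_eq_trace_submatrix_mul e]
    congr 2
    ext p q
    simp only [e, equivBCA, kron3, submatrix_apply, of_apply, kroneckerMap_apply,
      Equiv.prodComm_apply, Prod.fst_swap, Prod.snd_swap]
    ring
  · let e := equivACB (Fin d)
    refine sum_sq_correlation_eq hlam (X := ρ.submatrix e e) (fun _ _ _ _ => hrank _ _ _ _)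
      (htr e) (T := fun A C B => (ρ * kron3 A B C).trace) fun A C B => ?_
    rw [trace_mul_eq_trace_submatrix_mul e]
    congr 2
    ext p q
    simp only [e, equivACB, kron3, submatrix_apply, of_apply, kroneckerMap_apply,
      Equiv.coe_fn_mk]
    ring

end SpinCorr3
end

section
/- Let ρ be a pure tripartite qudit state on ℂ^d ⊗ ℂ^d ⊗ ℂ^d. Then the squared Frobenius norm of each spin correlation matrix is bounded: ‖R^{AB}‖² ≤ d − 1 + d‖c‖² ≤ d² − 1, and analogously ‖R^{BC}‖² ≤ d − 1 + d‖a‖² ≤ d² − 1 and ‖R^{AC}‖² ≤ d − 1 + d‖b‖² ≤ d² − 1. -/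
open Matrix ComplexOrder

namespace SpinCorr3

variable {d : ℕ}

variable (lam : Fin (d ^ 2 - 1) → Matrix (Fin d) (Fin d) ℂ)
variable (ρ : Matrix (Fin d × Fin d × Fin d) (Fin d × Fin d × Fin d) ℂ)

theorem ofReal_sum_norm_sq {m : Type*} [Fintype m] (f : m → ℂ) :
    ((∑ i, ‖f i‖ ^ 2 : ℝ) : ℂ) = star f ⬝ᵥ f := by
  simp [dotProduct, Complex.conj_mul']

/-- A Hermitian idempotent of trace one is the projection onto a unit vector. -/
theorem exists_eq_vecMulVec_of_isHermitian_of_idempotent {m : Type*} [Fintype m] [DecidableEq m]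
    {P : Matrix m m ℂ} (hP : P.IsHermitian) (hPP : P * P = P) (htr : P.trace = 1) :
    ∃ v : m → ℂ, P = vecMulVec v (star v) ∧ ∑ p, ‖v p‖ ^ 2 = 1 := by
  have hP0 : P ≠ 0 := by
    rintro rfl
    simp at htr
  obtain ⟨q, hq⟩ : ∃ q, P.col q ≠ 0 := by
    by_contra! h
    exact hP0 (by ext i j; exact congrFun (h j) i)
  set u := P.col q
  have hPu : P *ᵥ u = u := by
    ext i
    exact congrFun (congrFun hPP i) q
  have hs : 0 < ∑ p, ‖u p‖ ^ 2 := by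
    obtain ⟨i, hi⟩ := Function.ne_iff.mp hq
    exact Finset.sum_pos' (fun _ _ => by positivity)
      ⟨i, Finset.mem_univ i, by have := norm_pos_iff.mpr hi; positivity⟩
  set s := ∑ p, ‖u p‖ ^ 2
  let v : m → ℂ := ((√s)⁻¹ : ℂ) • u
  have hPv : P *ᵥ v = v := by simp only [v, mulVec_smul, hPu]
  have hv : ∑ p, ‖v p‖ ^ 2 = 1 := by
    have : ∀ p, ‖v p‖ ^ 2 = s⁻¹ * ‖u p‖ ^ 2 := fun p => by
      simp [v, mul_pow, Real.sq_sqrt hs.le]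
    simp only [this, ← Finset.mul_sum]
    exact inv_mul_cancel₀ hs.ne'
  have hvv : star v ⬝ᵥ v = 1 := by
    rw [← ofReal_sum_norm_sq, hv, Complex.ofReal_one]
  have hvP : star v ᵥ* P = star v := by
    have := congrArg star hPv
    rwa [star_mulVec, hP.eq] at this
  have hPV : P * vecMulVec v (star v) = vecMulVec v (star v) := by
    rw [mul_vecMulVec, hPv]
  have hVP : vecMulVec v (star v) * P = vecMulVec v (star v) := by
    rw [vecMulVec_mul, hvP]
  have hVV : vecMulVec v (star v) * vecMulVec v (star v) = vecMulVec v (star v) := by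
    rw [vecMulVec_mul_vecMulVec, hvv, one_smul]
  refine ⟨v, ?_, hv⟩
  rw [← sub_eq_zero, ← trace_conjTranspose_mul_self_eq_zero_iff, conjTranspose_sub, hP.eq,
    conjTranspose_vecMulVec, star_star, sub_mul, mul_sub, mul_sub, hPP, hPV, hVP, hVV,
    sub_self, sub_zero, trace_sub, htr, trace_vecMulVec, dotProduct_comm, hvv, sub_self]

/-- Parseval's identity for an orthogonal family of full cardinality. -/
theorem sum_norm_sq_sum_mul_eq {κ X : Type*} [Fintype κ] [Fintype X] [DecidableEq κ]
    (hcard : Fintype.card κ = Fintype.card X) {c : ℝ} (hc : c ≠ 0) (F : κ → X → ℂ)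
    (hF : ∀ k l, ∑ x, F k x * star (F l x) = if k = l then (c : ℂ) else 0) (m : X → ℂ) :
    ∑ k, ‖∑ x, m x * F k x‖ ^ 2 = c * ∑ x, ‖m x‖ ^ 2 := by
  classical
  have hc' : (c : ℂ) ≠ 0 := Complex.ofReal_ne_zero.mpr hc
  have h1 : Matrix.of F * ((c : ℂ)⁻¹ • (Matrix.of F)ᴴ) = 1 := by
    ext k l
    rw [Matrix.mul_smul, Matrix.smul_apply, mul_apply]
    simp only [of_apply, conjTranspose_apply, hF, one_apply]
    split_ifs <;> simp [hc']
  have h2 : (Matrix.of F)ᴴ * Matrix.of F = (c : ℂ) • 1 := by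
    rw [mul_eq_one_comm_of_card_eq _ _ _ hcard, Matrix.smul_mul] at h1
    rw [← h1, smul_smul, mul_inv_cancel₀ hc', one_smul]
  have hFm : (fun k => ∑ x, m x * F k x) = Matrix.of F *ᵥ m := by
    ext k
    simp [mulVec, dotProduct, mul_comm]
  apply Complex.ofReal_injective
  rw [Complex.ofReal_mul, ofReal_sum_norm_sq, ofReal_sum_norm_sq, hFm, star_mulVec,
    ← dotProduct_mulVec, mulVec_mulVec, h2, smul_mulVec, one_mulVec, dotProduct_smul, smul_eq_mul]

theorem sum_rotate {X Y Z M : Type*} [Fintype X] [Fintype Y] [Fintype Z] [AddCommMonoid M]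
    (f : X → Y → Z → M) : ∑ x, ∑ y, ∑ z, f x y z = ∑ z, ∑ x, ∑ y, f x y z :=
  (Finset.sum_congr rfl fun _ _ => Finset.sum_comm).trans Finset.sum_comm

/-- The two Gram matrices of a rectangular matrix have equal Frobenius norm. -/
theorem sum_norm_sq_gram_eq {X K : Type*} [Fintype X] [Fintype K] (W : X → K → ℂ) :
    ∑ x, ∑ x', ‖∑ k, W x k * star (W x' k)‖ ^ 2 =
      ∑ k, ∑ l, ‖∑ x, W x k * star (W x l)‖ ^ 2 := by
  apply Complex.ofReal_injective
  push_cast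
  simp only [← Complex.mul_conj', map_sum, map_mul, Finset.sum_mul_sum, starRingEnd_apply,
    star_star]
  calc _ = ∑ x, ∑ k, ∑ x', ∑ l, W x k * star (W x' k) * (star (W x l) * W x' l) :=
        Finset.sum_congr rfl fun x _ => Finset.sum_comm
    _ = ∑ k, ∑ x, ∑ l, ∑ x', W x k * star (W x' k) * (star (W x l) * W x' l) := by
        rw [Finset.sum_comm]
        exact Finset.sum_congr rfl fun k _ => Finset.sum_congr rfl fun x _ => Finset.sum_comm
    _ = _ := by
        refine Finset.sum_congr rfl fun k _ => ?_
        rw [Finset.sum_comm]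
        refine Finset.sum_congr rfl fun l _ => Finset.sum_congr rfl fun x _ =>
          Finset.sum_congr rfl fun x' _ => ?_
        ring

/-- The purity of a reduced state is at most the square of its trace. -/
theorem sum_norm_sq_gram_le {X K : Type*} [Fintype X] [Fintype K] (W : X → K → ℂ) :
    ∑ k, ∑ l, ‖∑ x, W x k * star (W x l)‖ ^ 2 ≤ (∑ k, ∑ x, ‖W x k‖ ^ 2) ^ 2 := by
  rw [sq (∑ k, _), Finset.sum_mul_sum]
  refine Finset.sum_le_sum fun k _ => Finset.sum_le_sum fun l _ => ?_
  calc ‖∑ x, W x k * star (W x l)‖ ^ 2 ≤ (∑ x, ‖W x k‖ * ‖W x l‖) ^ 2 := by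
        gcongr
        exact (norm_sum_le _ _).trans_eq (by simp)
    _ ≤ _ := Finset.sum_mul_sq_le_sq_mul_sq _ _ _

/-- The bounds for a pure state with coefficients `w i j k`, where the correlation matrix is that of
the first two tensor factors and the Bloch vector is that of the third one. -/
theorem correlation_bounds_of_coefficients (hd : 2 ≤ d)
    {lam : Fin (d ^ 2 - 1) → Matrix (Fin d) (Fin d) ℂ}
    (hherm : ∀ i, (lam i).IsHermitian) (htr0 : ∀ i, (lam i).trace = 0)
    (horth : ∀ i j, (lam i * lam j).trace = if i = j then (d : ℂ) else 0)
    (w : Fin d → Fin d → Fin d → ℂ) (hw : ∑ i, ∑ j, ∑ k, ‖w i j k‖ ^ 2 = 1)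
    {R c : ℝ}
    (hR : R = ∑ s, ∑ t, ‖∑ i, ∑ i', ∑ j, ∑ j',
      (∑ k, w i j k * star (w i' j' k)) * (lam s i' i * lam t j' j)‖ ^ 2)
    (hc : c = ∑ s, ‖∑ k, ∑ l, (∑ i, ∑ j, w i j k * star (w i j l)) * lam s l k‖ ^ 2) :
    R ≤ (d : ℝ) - 1 + (d : ℝ) * c ∧ (d : ℝ) - 1 + (d : ℝ) * c ≤ (d : ℝ) ^ 2 - 1 := by
  have hd0 : (d : ℝ) ≠ 0 := by positivity
  let F : Option (Fin (d ^ 2 - 1)) → Fin d × Fin d → ℂ :=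
    fun s x => s.elim (1 : Matrix (Fin d) (Fin d) ℂ) lam x.2 x.1
  have hcard : Fintype.card (Option (Fin (d ^ 2 - 1))) = Fintype.card (Fin d × Fin d) := by
    have : 0 < d ^ 2 := by positivity
    simp only [Fintype.card_option, Fintype.card_fin, Fintype.card_prod]
    rw [← sq]
    omega
  have hF : ∀ s t, ∑ x, F s x * star (F t x) = if s = t then ((d : ℝ) : ℂ) else 0 := by
    have key : ∀ s t, ∑ x, F s x * star (F t x) =
        (s.elim (1 : Matrix (Fin d) (Fin d) ℂ) lam *
          (t.elim (1 : Matrix (Fin d) (Fin d) ℂ) lam)).trace := fun s t => by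
      have ht : (t.elim (1 : Matrix (Fin d) (Fin d) ℂ) lam).IsHermitian := by
        cases t
        exacts [isHermitian_one, hherm _]
      simp only [F, trace, diag_apply, mul_apply, ht.apply, Fintype.sum_prod_type]
      exact Finset.sum_comm
    intro s t
    rw [key]
    cases s <;> cases t <;> simp [htr0, horth]
  have hG : ∀ p q : Option (Fin (d ^ 2 - 1)) × Option (Fin (d ^ 2 - 1)),
      ∑ x : (Fin d × Fin d) × (Fin d × Fin d),
        F p.1 x.1 * F p.2 x.2 * star (F q.1 x.1 * F q.2 x.2) =
      if p = q then (((d : ℝ) ^ 2 : ℝ) : ℂ) else 0 := fun p q => by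
    have : ∀ x : (Fin d × Fin d) × (Fin d × Fin d),
        F p.1 x.1 * F p.2 x.2 * star (F q.1 x.1 * F q.2 x.2) =
          (F p.1 x.1 * star (F q.1 x.1)) * (F p.2 x.2 * star (F q.2 x.2)) := fun x => by
      rw [star_mul']
      ring
    simp only [this]
    rw [Fintype.sum_prod_type]
    simp only [← Finset.mul_sum, ← Finset.sum_mul, hF, Prod.ext_iff]
    by_cases h1 : p.1 = q.1 <;> by_cases h2 : p.2 = q.2 <;> simp [h1, h2, sq]
  have hw' : ∑ k, ∑ x : Fin d × Fin d, ‖w x.1 x.2 k‖ ^ 2 = 1 := by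
    rw [Finset.sum_comm, Fintype.sum_prod_type]
    exact hw
  have htrace : ∑ x : Fin d × Fin d, ∑ k, w x.1 x.2 k * star (w x.1 x.2 k) = 1 := by
    rw [← Complex.ofReal_one, ← hw, Fintype.sum_prod_type]
    simp [Complex.mul_conj']
  have hC := sum_norm_sq_sum_mul_eq hcard hd0 F hF
    fun y => ∑ x : Fin d × Fin d, w x.1 x.2 y.1 * star (w x.1 x.2 y.2)
  have hAB := sum_norm_sq_sum_mul_eq (by simp only [Fintype.card_prod, hcard])
    (pow_ne_zero 2 hd0) (fun (p : Option (Fin (d ^ 2 - 1)) × Option (Fin (d ^ 2 - 1)))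
      (x : (Fin d × Fin d) × (Fin d × Fin d)) => F p.1 x.1 * F p.2 x.2) hG
    fun x => ∑ k, w x.1.1 x.2.1 k * star (w x.1.2 x.2.2 k)
  have hswap : ∑ x : (Fin d × Fin d) × (Fin d × Fin d),
      ‖∑ k, w x.1.1 x.2.1 k * star (w x.1.2 x.2.2 k)‖ ^ 2 =
      ∑ y : Fin d × Fin d, ‖∑ x : Fin d × Fin d, w x.1 x.2 y.1 * star (w x.1 x.2 y.2)‖ ^ 2 := by
    rw [Fintype.sum_prod_type (f := fun y : Fin d × Fin d => _),
      ← sum_norm_sq_gram_eq fun (x : Fin d × Fin d) k => w x.1 x.2 k,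
      ← (Equiv.prodProdProdComm (Fin d) (Fin d) (Fin d) (Fin d)).sum_comp,
      Fintype.sum_prod_type]
    rfl
  have hle := sum_norm_sq_gram_le fun (x : Fin d × Fin d) k => w x.1 x.2 k
  rw [hw', ← Fintype.sum_prod_type'
    (f := fun k l => ‖∑ x : Fin d × Fin d, w x.1 x.2 k * star (w x.1 x.2 l)‖ ^ 2)] at hle
  rw [hswap] at hAB
  set τ := ∑ y : Fin d × Fin d,
    ‖∑ x : Fin d × Fin d, w x.1 x.2 y.1 * star (w x.1 x.2 y.2)‖ ^ 2
  have hC' : 1 + c = d * τ := by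
    rw [← hC, Fintype.sum_option, hc]
    congr 1
    · have : ∑ y : Fin d × Fin d, (∑ x : Fin d × Fin d,
          w x.1 x.2 y.1 * star (w x.1 x.2 y.2)) * F none y = 1 := by
        rw [← htrace, Finset.sum_comm, Fintype.sum_prod_type]
        simp [F, one_apply]
      rw [this]
      simp
    · simp [F, Fintype.sum_prod_type]
  have hAB' : 1 + R ≤ d ^ 2 * τ := by
    have hnone : ∑ x : (Fin d × Fin d) × (Fin d × Fin d),
        (∑ k, w x.1.1 x.2.1 k * star (w x.1.2 x.2.2 k)) * (F none x.1 * F none x.2) = 1 := by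
      rw [← htrace]
      simp [F, one_apply, Fintype.sum_prod_type]
    rw [← hAB, Fintype.sum_prod_type, Fintype.sum_option, Fintype.sum_option, hnone, hR]
    simp only [Fintype.sum_option, Finset.sum_add_distrib]
    have e : ∑ s, ∑ t, ‖∑ i, ∑ i', ∑ j, ∑ j',
        (∑ k, w i j k * star (w i' j' k)) * (lam s i' i * lam t j' j)‖ ^ 2 =
        ∑ s, ∑ t, ‖∑ x : (Fin d × Fin d) × (Fin d × Fin d),
          (∑ k, w x.1.1 x.2.1 k * star (w x.1.2 x.2.2 k)) *
            (F (some s) x.1 * F (some t) x.2)‖ ^ 2 := by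
      simp [F, Fintype.sum_prod_type]
    rw [e, norm_one, one_pow]
    gcongr ?_ + ?_
    · exact le_add_of_nonneg_right (by positivity)
    · exact le_add_of_nonneg_left (by positivity)
  constructor
  · nlinarith
  · have : (0 : ℝ) ≤ (d : ℝ) ^ 2 := by positivity
    nlinarith

/-- Bounds on the squared Frobenius norms of the spin correlation matrices of a pure
tripartite qudit state (Eq. (8) of the paper and its analogues). -/
theorem spin_correlation_matrix_bounds (d : ℕ) (hd : 2 ≤ d)
    (lam : Fin (d ^ 2 - 1) → Matrix (Fin d) (Fin d) ℂ)
    (hherm : ∀ i, (lam i).IsHermitian)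
    (htr0 : ∀ i, (lam i).trace = 0)
    (horth : ∀ i j, (lam i * lam j).trace = if i = j then (d : ℂ) else 0)
    (ρ : Matrix (Fin d × Fin d × Fin d) (Fin d × Fin d × Fin d) ℂ)
    (hpsd : ρ.PosSemidef) (htr1 : ρ.trace = 1) (hpure : ρ * ρ = ρ) :
    (RABsq lam ρ ≤ (d : ℝ) - 1 + (d : ℝ) * cSq lam ρ ∧
      (d : ℝ) - 1 + (d : ℝ) * cSq lam ρ ≤ (d : ℝ) ^ 2 - 1) ∧
    (RBCsq lam ρ ≤ (d : ℝ) - 1 + (d : ℝ) * aSq lam ρ ∧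
      (d : ℝ) - 1 + (d : ℝ) * aSq lam ρ ≤ (d : ℝ) ^ 2 - 1) ∧
    (RACsq lam ρ ≤ (d : ℝ) - 1 + (d : ℝ) * bSq lam ρ ∧
      (d : ℝ) - 1 + (d : ℝ) * bSq lam ρ ≤ (d : ℝ) ^ 2 - 1) := by
  obtain ⟨v, rfl, hv⟩ :=
    exists_eq_vecMulVec_of_isHermitian_of_idempotent hpsd.isHermitian hpure htr1
  simp only [Fintype.sum_prod_type] at hv
  refine ⟨correlation_bounds_of_coefficients hd hherm htr0 horth (fun i j k => v (i, j, k)) hv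
      ?_ ?_,
    correlation_bounds_of_coefficients hd hherm htr0 horth (fun j k i => v (i, j, k)) ?_ ?_ ?_,
    correlation_bounds_of_coefficients hd hherm htr0 horth (fun i k j => v (i, j, k)) ?_ ?_ ?_⟩
  · refine Finset.sum_congr rfl fun s _ => Finset.sum_congr rfl fun t _ => ?_
    congr 2
    simp [trace, mul_apply, kron3, vecMulVec_apply, Fintype.sum_prod_type, one_apply,
      Finset.sum_mul]
    exact Finset.sum_congr rfl fun i _ => (sum_rotate _).trans <|
      Finset.sum_congr rfl fun i' _ => Finset.sum_congr rfl fun j _ => Finset.sum_comm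
  · refine Finset.sum_congr rfl fun s _ => ?_
    congr 2
    simp [trace, mul_apply, kron3, vecMulVec_apply, Fintype.sum_prod_type, one_apply,
      Finset.sum_mul]
    exact (sum_rotate _).trans <| Finset.sum_congr rfl fun k _ => sum_rotate _
  · exact (sum_rotate _).trans hv
  · refine Finset.sum_congr rfl fun s _ => Finset.sum_congr rfl fun t _ => ?_
    congr 2
    simp [trace, mul_apply, kron3, vecMulVec_apply, Fintype.sum_prod_type, one_apply,
      Finset.sum_mul]
    exact Finset.sum_comm.trans <| Finset.sum_congr rfl fun j _ => (sum_rotate _).trans <|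
      Finset.sum_congr rfl fun j' _ => (sum_rotate _).symm
  · refine Finset.sum_congr rfl fun s _ => ?_
    congr 2
    simp [trace, mul_apply, kron3, vecMulVec_apply, Fintype.sum_prod_type, one_apply,
      Finset.sum_mul]
    exact Finset.sum_congr rfl fun i _ => sum_rotate _
  · exact (Finset.sum_congr rfl fun i _ => Finset.sum_comm).trans hv
  · refine Finset.sum_congr rfl fun s _ => Finset.sum_congr rfl fun t _ => ?_
    congr 2
    simp [trace, mul_apply, kron3, vecMulVec_apply, Fintype.sum_prod_type, one_apply,
      Finset.sum_mul]
    exact Finset.sum_congr rfl fun i _ => (sum_rotate _).trans <|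
      Finset.sum_congr rfl fun i' _ => (sum_rotate _).symm
  · refine Finset.sum_congr rfl fun s _ => ?_
    congr 2
    simp [trace, mul_apply, kron3, vecMulVec_apply, Fintype.sum_prod_type, one_apply,
      Finset.sum_mul]
    exact Finset.sum_comm.trans <| Finset.sum_congr rfl fun j _ => sum_rotate _

end SpinCorr3
end

section
/- (Lemma 2.1) Let ρ be a pure tripartite qudit state on ℂ^d ⊗ ℂ^d ⊗ ℂ^d. Then its local Bloch vectors and tripartite correlation tensor satisfy the identity ‖a‖² + ‖b‖² + ‖c‖² + ‖R^{ABC}‖²/(d−1) = (d+2)(d−1). -/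
open Matrix ComplexOrder

namespace SpinCorr3

variable {d : ℕ}

variable (lam : Fin (d ^ 2 - 1) → Matrix (Fin d) (Fin d) ℂ)
variable (ρ : Matrix (Fin d × Fin d × Fin d) (Fin d × Fin d × Fin d) ℂ)

/-- The family `lam` completed by the identity matrix. -/
noncomputable def extendOne (o : Option (Fin (d ^ 2 - 1))) : Matrix (Fin d) (Fin d) ℂ :=
  o.elim 1 lam

/-- A family of matrices satisfies the completeness relation with constant `c` if
`∑ k, M k ⊗ M k` is `c` times the swap operator. -/
def IsComplete {K X : Type*} [Fintype K] [DecidableEq X] (c : ℂ) (M : K → Matrix X X ℂ) : Prop :=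
  ∀ x x' y y', ∑ k, M k x x' * M k y y' = if x = y' ∧ x' = y then c else 0

theorem IsComplete.of_trace_mul {K X : Type*} [Fintype K] [DecidableEq K] [Fintype X]
    [DecidableEq X] {c : ℂ} (hc : c ≠ 0) (e : K ≃ X × X) {M : K → Matrix X X ℂ}
    (h : ∀ i j, (M i * M j).trace = if i = j then c else 0) : IsComplete c M := by
  intro x x' y y'
  have h1 : (Matrix.of fun (k : K) (p : X × X) => c⁻¹ * M k p.1 p.2) *
      (Matrix.of fun (p : X × X) (k : K) => M k p.2 p.1) = 1 := by
    ext i j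
    have := h i j
    simp only [Matrix.trace, Matrix.diag, Matrix.mul_apply] at this
    simp only [Matrix.mul_apply, Matrix.of_apply, Fintype.sum_prod_type, mul_assoc,
      ← Finset.mul_sum, this, Matrix.one_apply]
    split_ifs <;> simp [hc]
  have h2 := congrFun (congrFun ((Matrix.mul_eq_one_comm_of_equiv e).1 h1) (x', x)) (y, y')
  simp only [Matrix.mul_apply, Matrix.of_apply, Matrix.one_apply, Prod.mk.injEq] at h2
  have h3 : ∑ k, M k x x' * M k y y' = c * ∑ k, M k x x' * (c⁻¹ * M k y y') := by
    rw [Finset.mul_sum]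
    refine Finset.sum_congr rfl fun k _ => ?_
    field_simp
  rw [h3, h2]
  simp only [and_comm, mul_ite, mul_one, mul_zero]

theorem IsComplete.kronecker {K L X Y : Type*} [Fintype K] [Fintype L] [DecidableEq X]
    [DecidableEq Y] {c c' : ℂ} {M : K → Matrix X X ℂ} {N : L → Matrix Y Y ℂ}
    (hM : IsComplete c M) (hN : IsComplete c' N) :
    IsComplete (c * c') fun p : K × L => Matrix.kronecker (M p.1) (N p.2) := by
  rintro ⟨x, u⟩ ⟨x', u'⟩ ⟨y, v⟩ ⟨y', v'⟩
  have h : ∀ p : K × L, Matrix.kronecker (M p.1) (N p.2) (x, u) (x', u') *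
      Matrix.kronecker (M p.1) (N p.2) (y, v) (y', v') =
      (M p.1 x x' * M p.1 y y') * (N p.2 u u' * N p.2 v v') := fun p => by
    simp only [Matrix.kronecker, Matrix.kroneckerMap_apply]; ring
  simp only [h, Fintype.sum_prod_type, ← Finset.mul_sum, ← Finset.sum_mul, hM x x' y y',
    hN u u' v v', Prod.mk.injEq]
  split_ifs <;> simp_all

theorem IsComplete.sum_trace_sq {K X : Type*} [Fintype K] [Fintype X] [DecidableEq X] {c : ℂ}
    {M : K → Matrix X X ℂ} (hM : IsComplete c M) (f : Matrix X X ℂ) :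
    ∑ k, (f * M k).trace ^ 2 = c * (f * f).trace := by
  have h : ∀ k, (f * M k).trace ^ 2 =
      ∑ x, ∑ x', ∑ y, ∑ y', f x x' * f y y' * (M k x' x * M k y' y) := fun k => by
    simp only [sq, Matrix.trace, Matrix.diag, Matrix.mul_apply, Finset.sum_mul, Finset.mul_sum]
    refine Finset.sum_congr rfl fun x _ => ?_
    refine Finset.sum_congr rfl fun x' _ => Finset.sum_congr rfl fun y _ =>
      Finset.sum_congr rfl fun y' _ => by ring
  simp only [h]
  rw [Finset.sum_comm]
  simp only [Matrix.trace, Matrix.diag, Matrix.mul_apply, Finset.mul_sum]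
  refine Finset.sum_congr rfl fun x _ => ?_
  rw [Finset.sum_comm]
  refine Finset.sum_congr rfl fun x' _ => ?_
  rw [Finset.sum_comm, Finset.sum_eq_single x']
  · rw [Finset.sum_comm, Finset.sum_eq_single x]
    · rw [← Finset.mul_sum, hM]; simp; ring
    · intro y' _ hy; rw [← Finset.mul_sum, hM]; simp [Ne.symm hy]
    · simp
  · intro y _ hy
    rw [Finset.sum_comm]
    refine Finset.sum_eq_zero fun y' _ => ?_
    rw [← Finset.mul_sum, hM]; simp [Ne.symm hy]
  · simp

theorem isComplete_extendOne (hd : 2 ≤ d) (htr0 : ∀ i, (lam i).trace = 0)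
    (horth : ∀ i j, (lam i * lam j).trace = if i = j then (d : ℂ) else 0) :
    IsComplete (d : ℂ) (extendOne lam) := by
  have hpos : 0 < d ^ 2 := by positivity
  refine IsComplete.of_trace_mul (by norm_cast; omega) (Fintype.equivOfCardEq ?_) ?_
  · simp only [Fintype.card_option, Fintype.card_fin, Fintype.card_prod]
    rw [← sq]; omega
  · rintro (_ | i) (_ | j) <;> simp [extendOne, htr0, horth]

/-- All `2 × 2` minors of the matrix vanish, as for a matrix of rank at most one. -/
def IsRankOneLike {X : Type*} (σ : Matrix X X ℂ) : Prop :=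
  ∀ p q r s, σ p q * σ r s = σ p s * σ r q

theorem isRankOneLike_of_idempotent {X : Type*} [Fintype X] [DecidableEq X] {σ : Matrix X X ℂ}
    (htr : σ.trace = 1) (hσ : σ * σ = σ) : IsRankOneLike σ := by
  have hid : IsIdempotentElem (Matrix.toLin' σ) := by
    rw [IsIdempotentElem, Module.End.mul_eq_comp, ← Matrix.toLin'_mul, hσ]
  have hrank : Module.finrank ℂ (LinearMap.range (Matrix.toLin' σ)) = 1 := by
    have h := (LinearMap.IsIdempotentElem.isProj_range _ hid).trace
    rw [Matrix.trace_toLin'_eq, htr] at h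
    exact_mod_cast h.symm
  obtain ⟨v, -, hv⟩ := finrank_eq_one_iff'.1 hrank
  have hcol : ∀ q, ∃ c : ℂ, ∀ p, σ p q = c * v.1 p := fun q => by
    obtain ⟨c, hc⟩ := hv ⟨Matrix.toLin' σ (Pi.single q 1), LinearMap.mem_range_self _ _⟩
    refine ⟨c, fun p => ?_⟩
    have := congrFun (congrArg Subtype.val hc) p
    simpa using this.symm
  choose w hw using hcol
  intro p q r s
  rw [hw, hw, hw, hw]; ring

/-- Reduced state of the first party. -/
def traceRight {X Y : Type*} [Fintype Y] (σ : Matrix (X × Y) (X × Y) ℂ) : Matrix X X ℂ :=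
  Matrix.of fun x x' => ∑ y, σ (x, y) (x', y)

/-- Reduced state of the second party. -/
def traceLeft {X Y : Type*} [Fintype X] (σ : Matrix (X × Y) (X × Y) ℂ) : Matrix Y Y ℂ :=
  Matrix.of fun y y' => ∑ x, σ (x, y) (x, y')

theorem IsRankOneLike.trace_sq_traceRight {X Y : Type*} [Fintype X] [Fintype Y]
    {σ : Matrix (X × Y) (X × Y) ℂ} (h : IsRankOneLike σ) :
    (traceRight σ * traceRight σ).trace = (traceLeft σ * traceLeft σ).trace := by
  have hl : (traceRight σ * traceRight σ).trace =
      ∑ x, ∑ x', ∑ y, ∑ y', σ (x, y) (x, y') * σ (x', y') (x', y) := by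
    simp only [Matrix.trace, Matrix.diag, Matrix.mul_apply, traceRight, Matrix.of_apply,
      Finset.sum_mul_sum]
    refine Finset.sum_congr rfl fun x _ => Finset.sum_congr rfl fun x' _ =>
      Finset.sum_congr rfl fun y _ => Finset.sum_congr rfl fun y' _ => h _ _ _ _
  have hr : (traceLeft σ * traceLeft σ).trace =
      ∑ y, ∑ y', ∑ x, ∑ x', σ (x, y) (x, y') * σ (x', y') (x', y) := by
    simp only [Matrix.trace, Matrix.diag, Matrix.mul_apply, traceLeft, Matrix.of_apply,
      Finset.sum_mul_sum]
  rw [hl, hr]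
  calc _ = ∑ x, ∑ y, ∑ x', ∑ y', σ (x, y) (x, y') * σ (x', y') (x', y) :=
        Finset.sum_congr rfl fun x _ => Finset.sum_comm
    _ = ∑ y, ∑ x, ∑ x', ∑ y', σ (x, y) (x, y') * σ (x', y') (x', y) := Finset.sum_comm
    _ = ∑ y, ∑ x, ∑ y', ∑ x', σ (x, y) (x, y') * σ (x', y') (x', y) :=
        Finset.sum_congr rfl fun y _ => Finset.sum_congr rfl fun x _ => Finset.sum_comm
    _ = _ := Finset.sum_congr rfl fun y _ => Finset.sum_comm

theorem trace_mul_kronecker_one {X Y : Type*} [Fintype X] [Fintype Y] [DecidableEq Y]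
    (σ : Matrix (X × Y) (X × Y) ℂ) (A : Matrix X X ℂ) :
    (σ * Matrix.kronecker A (1 : Matrix Y Y ℂ)).trace = (traceRight σ * A).trace := by
  simp only [Matrix.trace, Matrix.diag, Matrix.mul_apply, traceRight, Matrix.of_apply,
    Matrix.kronecker, Matrix.kroneckerMap_apply, Fintype.sum_prod_type, Matrix.one_apply,
    mul_ite, mul_one, mul_zero, Finset.sum_ite_eq', Finset.mem_univ, if_true, Finset.sum_mul]
  exact Finset.sum_congr rfl fun x _ => Finset.sum_comm

theorem trace_mul_one_kronecker {X Y : Type*} [Fintype X] [Fintype Y] [DecidableEq X]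
    (σ : Matrix (X × Y) (X × Y) ℂ) (B : Matrix Y Y ℂ) :
    (σ * Matrix.kronecker (1 : Matrix X X ℂ) B).trace = (traceLeft σ * B).trace := by
  simp only [Matrix.trace, Matrix.diag, Matrix.mul_apply, traceLeft, Matrix.of_apply,
    Matrix.kronecker, Matrix.kroneckerMap_apply, Fintype.sum_prod_type, Matrix.one_apply,
    ite_mul, one_mul, zero_mul, mul_ite, mul_zero, Finset.sum_mul]
  rw [Finset.sum_comm]
  refine Finset.sum_congr rfl fun y _ => ?_
  rw [Finset.sum_comm (s := Finset.univ (α := Y))]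
  refine Finset.sum_congr rfl fun x _ => ?_
  rw [Finset.sum_comm]
  simp

theorem kron3_eq_kronecker (A B C : Matrix (Fin d) (Fin d) ℂ) :
    kron3 A B C = Matrix.kronecker A (Matrix.kronecker B C) := by
  ext p q
  simp [kron3, Matrix.kronecker, mul_assoc]

theorem isHermitian_kron3 {A B C : Matrix (Fin d) (Fin d) ℂ} (hA : A.IsHermitian)
    (hB : B.IsHermitian) (hC : C.IsHermitian) : (kron3 A B C).IsHermitian := by
  ext p q
  simp [kron3, hA.apply, hB.apply, hC.apply]

theorem ofReal_norm_trace_mul_sq {X : Type*} [Fintype X] {A B : Matrix X X ℂ}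
    (hA : A.IsHermitian) (hB : B.IsHermitian) :
    ((‖(A * B).trace‖ ^ 2 : ℝ) : ℂ) = (A * B).trace ^ 2 := by
  have h : star (A * B).trace = (A * B).trace := by
    rw [← Matrix.trace_conjTranspose, Matrix.conjTranspose_mul, hA.eq, hB.eq, Matrix.trace_mul_comm]
  have h' : (starRingEnd ℂ) (A * B).trace = (A * B).trace := h
  rw [Complex.ofReal_pow, ← Complex.mul_conj', h', sq]

theorem sum_single_eq_sum_pair {M : Option (Fin (d ^ 2 - 1)) → Matrix (Fin d) (Fin d) ℂ}
    (hM : IsComplete (d : ℂ) M) {ρ : Matrix (Fin d × Fin d × Fin d) (Fin d × Fin d × Fin d) ℂ}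
    (h : IsRankOneLike ρ) :
    d * ∑ i, (ρ * kron3 (M i) 1 1).trace ^ 2 =
      ∑ j, ∑ l, (ρ * kron3 1 (M j) (M l)).trace ^ 2 := by
  have h1 := hM.sum_trace_sq (traceRight ρ)
  have h2 := (hM.kronecker hM).sum_trace_sq (traceLeft ρ)
  simp only [Fintype.sum_prod_type, ← trace_mul_one_kronecker, ← kron3_eq_kronecker,
    ← h.trace_sq_traceRight] at h2
  have h3 : ∀ A : Matrix (Fin d) (Fin d) ℂ,
      (traceRight ρ * A).trace = (ρ * kron3 A 1 1).trace := fun A => by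
    rw [← trace_mul_kronecker_one, kron3_eq_kronecker, Matrix.kronecker, Matrix.kronecker,
      Matrix.one_kronecker_one]
  rw [h2, mul_assoc, ← h1]
  simp only [h3]

theorem trace_submatrix_mul_submatrix {X Y : Type*} [Fintype X] [Fintype Y] (e : X ≃ Y)
    (A B : Matrix Y Y ℂ) : (A.submatrix e e * B.submatrix e e).trace = (A * B).trace := by
  rw [Matrix.submatrix_mul_equiv]
  exact e.sum_comp fun y => (A * B) y y

/-- Lemma 2.1: for a pure tripartite qudit state,
`‖a‖² + ‖b‖² + ‖c‖² + ‖R^{ABC}‖²/(d-1) = (d+2)(d-1)`. -/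
theorem bloch_invariant_identity_pure_tripartite (d : ℕ) (hd : 2 ≤ d)
    (lam : Fin (d ^ 2 - 1) → Matrix (Fin d) (Fin d) ℂ)
    (hherm : ∀ i, (lam i).IsHermitian)
    (htr0 : ∀ i, (lam i).trace = 0)
    (horth : ∀ i j, (lam i * lam j).trace = if i = j then (d : ℂ) else 0)
    (ρ : Matrix (Fin d × Fin d × Fin d) (Fin d × Fin d × Fin d) ℂ)
    (hpsd : ρ.PosSemidef) (htr1 : ρ.trace = 1) (hpure : ρ * ρ = ρ) :
    aSq lam ρ + bSq lam ρ + cSq lam ρ + RABCsq lam ρ / ((d : ℝ) - 1) =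
      ((d : ℝ) + 2) * ((d : ℝ) - 1) := by
  set M := extendOne lam
  have hM : IsComplete (d : ℂ) M := isComplete_extendOne lam hd htr0 horth
  have hrank := isRankOneLike_of_idempotent htr1 hpure
  have hfull := (hM.kronecker (hM.kronecker hM)).sum_trace_sq ρ
  have hA := sum_single_eq_sum_pair hM hrank
  let e : Fin d × Fin d × Fin d ≃ Fin d × Fin d × Fin d :=
    ⟨fun p => (p.2.1, p.1, p.2.2), fun p => (p.2.1, p.1, p.2.2), fun _ => rfl, fun _ => rfl⟩
  let f : Fin d × Fin d × Fin d ≃ Fin d × Fin d × Fin d :=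
    ⟨fun p => (p.2.1, p.2.2, p.1), fun p => (p.2.2, p.1, p.2.1), fun _ => rfl, fun _ => rfl⟩
  have he : ∀ A B C, (ρ.submatrix e e * kron3 A B C).trace = (ρ * kron3 B A C).trace :=
    fun A B C => by
    have h : kron3 A B C = (kron3 B A C).submatrix e e := by
      ext p q
      simp only [kron3, e, Matrix.submatrix_apply, Matrix.of_apply, Equiv.coe_fn_mk]; ring
    rw [h, trace_submatrix_mul_submatrix]
  have hf : ∀ A B C, (ρ.submatrix f f * kron3 A B C).trace = (ρ * kron3 B C A).trace :=
    fun A B C => by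
    have h : kron3 A B C = (kron3 B C A).submatrix f f := by
      ext p q
      simp only [kron3, f, Matrix.submatrix_apply, Matrix.of_apply, Equiv.coe_fn_mk]; ring
    rw [h, trace_submatrix_mul_submatrix]
  have hB := sum_single_eq_sum_pair hM (ρ := ρ.submatrix e e) fun p q r s => hrank _ _ _ _
  have hC := sum_single_eq_sum_pair hM (ρ := ρ.submatrix f f) fun p q r s => hrank _ _ _ _
  simp only [he] at hB
  simp only [hf] at hC
  simp only [Fintype.sum_prod_type, ← kron3_eq_kronecker, hpure, htr1] at hfull
  have hone : kron3 (1 : Matrix (Fin d) (Fin d) ℂ) 1 1 = 1 := by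
    simp [kron3_eq_kronecker]
  have hnone : M none = 1 := rfl
  have hsome : ∀ i, M (some i) = lam i := fun _ => rfl
  simp only [Fintype.sum_option, hnone, hsome, hone, mul_one, htr1, Finset.sum_add_distrib]
    at hfull hA hB hC
  have hd1 : (d : ℂ) - 1 ≠ 0 := by
    rw [sub_ne_zero]; norm_cast; omega
  have h1 : (1 : Matrix (Fin d) (Fin d) ℂ).IsHermitian := Matrix.isHermitian_one
  rw [← Complex.ofReal_inj]
  simp only [aSq, bSq, cSq, RABCsq, Complex.ofReal_add, Complex.ofReal_sub, Complex.ofReal_mul,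
    Complex.ofReal_div, Complex.ofReal_sum, Complex.ofReal_natCast, Complex.ofReal_one,
    Complex.ofReal_ofNat, ofReal_norm_trace_mul_sq hpsd.1 (isHermitian_kron3 (hherm _) h1 h1),
    ofReal_norm_trace_mul_sq hpsd.1 (isHermitian_kron3 h1 (hherm _) h1),
    ofReal_norm_trace_mul_sq hpsd.1 (isHermitian_kron3 h1 h1 (hherm _)),
    ofReal_norm_trace_mul_sq hpsd.1 (isHermitian_kron3 (hherm _) (hherm _) (hherm _))]
  field_simp
  linear_combination hfull + hA + hB + hC

end SpinCorr3
end

section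
/- (Corollary 2.2) Let ρ be any tripartite qudit state on ℂ^d ⊗ ℂ^d ⊗ ℂ^d (not necessarily pure). Then its tripartite correlation tensor satisfies ‖R^{ABC}‖² ≤ (d−1)²(d+2). -/
open Matrix ComplexOrder

namespace SpinCorr3

variable {d : ℕ}

variable (lam : Fin (d ^ 2 - 1) → Matrix (Fin d) (Fin d) ℂ)
variable (ρ : Matrix (Fin d × Fin d × Fin d) (Fin d × Fin d × Fin d) ℂ)

lemma sum_rotate_s4 {α β γ M : Type*} [Fintype α] [Fintype β] [Fintype γ] [AddCommMonoid M]
    (g : α → β → γ → M) : ∑ i, ∑ j, ∑ l, g i j l = ∑ j, ∑ l, ∑ i, g i j l := by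
  rw [Finset.sum_comm]
  exact Finset.sum_congr rfl fun j _ => Finset.sum_comm

lemma sum_swap_pairs {α α' β β' M : Type*} [Fintype α] [Fintype α'] [Fintype β] [Fintype β']
    [AddCommMonoid M] (g : α → α' → β → β' → M) :
    ∑ a, ∑ a', ∑ b, ∑ b', g a a' b b' = ∑ b, ∑ b', ∑ a, ∑ a', g a a' b b' := by
  rw [← sum_rotate_s4 fun a b b' => ∑ a', g a a' b b']
  exact Finset.sum_congr rfl fun a _ => sum_rotate_s4 (g a)

open Finset in
/-- A trace-orthogonal Hermitian family completed by the identity satisfies the completeness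
relation. -/
lemma sum_mul_star_entry (hd : 2 ≤ d)
    (hherm : ∀ i, (lam i).IsHermitian) (htr0 : ∀ i, (lam i).trace = 0)
    (horth : ∀ i j, (lam i * lam j).trace = if i = j then (d : ℂ) else 0)
    (a b c e : Fin d) :
    ∑ i, lam i a b * star (lam i c e) =
      (d : ℂ) * (if a = c ∧ b = e then 1 else 0)
        - (if a = b then 1 else 0) * (if c = e then 1 else 0) := by
  have hd0 : (d : ℂ) ≠ 0 := by
    have : d ≠ 0 := by omega
    exact_mod_cast this
  let L : Option (Fin (d ^ 2 - 1)) → Matrix (Fin d) (Fin d) ℂ := fun o => o.elim 1 lam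
  let U : Matrix (Option (Fin (d ^ 2 - 1))) (Fin d × Fin d) ℂ := Matrix.of fun o p => L o p.1 p.2
  have hpair : ∀ o o', ∑ p : Fin d × Fin d, L o p.1 p.2 * star (L o' p.1 p.2)
      = (L o * (L o')ᴴ).trace := by
    intro o o'
    simp [Matrix.trace, Matrix.mul_apply, Fintype.sum_prod_type]
  have hU : U * ((d : ℂ)⁻¹ • Uᴴ) = 1 := by
    ext o o'
    have : (U * Uᴴ) o o' = (L o * (L o')ᴴ).trace := by
      rw [← hpair]; simp [Matrix.mul_apply, U]
    rw [Matrix.mul_smul, Matrix.smul_apply, this]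
    rcases o with _ | i <;> rcases o' with _ | j
    · simp [L, hd0]
    · simp [L, (hherm j).eq, htr0]
    · simp [L, htr0]
    · have := horth i j
      simp only [L, Option.elim, (hherm j).eq, this, Matrix.one_apply, Option.some.injEq]
      split_ifs <;> simp [hd0]
  have hcard : Fintype.card (Option (Fin (d ^ 2 - 1))) = Fintype.card (Fin d × Fin d) := by
    have : 1 ≤ d ^ 2 := Nat.one_le_pow _ _ (by omega)
    simp only [Fintype.card_option, Fintype.card_fin, Fintype.card_prod]
    rw [Nat.sub_add_cancel this, sq]
  have hV := (Matrix.mul_eq_one_comm_of_card_eq _ _ _ hcard).1 hU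
  have h := congrFun (congrFun hV (c, e)) (a, b)
  rw [Matrix.smul_mul, Matrix.smul_apply, smul_eq_mul, inv_mul_eq_iff_eq_mul₀ hd0,
    Matrix.mul_apply, Fintype.sum_option] at h
  simp only [Matrix.conjTranspose_apply, U, L, Matrix.of_apply, Option.elim] at h
  rw [sum_congr rfl fun i _ => mul_comm (lam i a b) _, eq_sub_iff_add_eq, add_comm]
  convert h using 2
  · simp only [Matrix.one_apply]
    split_ifs <;> simp
  · simp only [Matrix.one_apply, Prod.mk.injEq, eq_comm]

/-- Parseval's identity for the coefficients against a trace-orthogonal basis of traceless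
Hermitian matrices. -/
def HasParseval (lam : Fin (d ^ 2 - 1) → Matrix (Fin d) (Fin d) ℂ) : Prop :=
  ∀ f : Fin d → Fin d → ℂ,
    ∑ i, ‖∑ a, ∑ a', f a a' * lam i a' a‖ ^ 2
      = d * ∑ a, ∑ a', ‖f a a'‖ ^ 2 - ‖∑ a, f a a‖ ^ 2

lemma hasParseval (hd : 2 ≤ d)
    (hherm : ∀ i, (lam i).IsHermitian) (htr0 : ∀ i, (lam i).trace = 0)
    (horth : ∀ i j, (lam i * lam j).trace = if i = j then (d : ℂ) else 0) :
    HasParseval lam := by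
  intro f
  have hsq : ∀ z : ℂ, ((‖z‖ ^ 2 : ℝ) : ℂ) = z * star z := fun z => by
    simpa using (Complex.mul_conj' z).symm
  apply Complex.ofReal_injective
  push_cast [-Complex.ofReal_pow]
  simp only [hsq]
  have h1 : ∀ i, (∑ a, ∑ a', f a a' * lam i a' a) * star (∑ a, ∑ a', f a a' * lam i a' a)
      = ∑ p : Fin d × Fin d, ∑ q : Fin d × Fin d,
        (f p.1 p.2 * star (f q.1 q.2)) * (lam i p.2 p.1 * star (lam i q.2 q.1)) := by
    intro i
    rw [← Fintype.sum_prod_type' (f := fun a a' => f a a' * lam i a' a), star_sum,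
      Finset.sum_mul_sum]
    refine Finset.sum_congr rfl fun p _ => Finset.sum_congr rfl fun q _ => ?_
    simp only [star_mul']
    ring
  simp only [h1]
  rw [Finset.sum_comm]
  simp_rw [Finset.sum_comm (s := (Finset.univ : Finset (Fin (d ^ 2 - 1)))), ← Finset.mul_sum,
    sum_mul_star_entry lam hd hherm htr0 horth, mul_sub, Finset.sum_sub_distrib]
  congr 1
  · simp only [← Fintype.sum_prod_type' (f := fun a a' => f a a' * star (f a a')),
      Finset.mul_sum]
    refine Finset.sum_congr rfl fun p _ => ?_
    rw [Finset.sum_eq_single p]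
    · simp; ring
    · intro q _ hq
      have : ¬ (p.2 = q.2 ∧ p.1 = q.1) := fun h => hq (Prod.ext h.2.symm h.1.symm)
      simp [this]
    · simp
  · simp only [Fintype.sum_prod_type, star_sum, Finset.sum_mul_sum]
    simp

variable {lam}

lemma HasParseval.sum_norm_sq (h : HasParseval lam) (f : Fin d → Fin d → ℂ) :
    ∑ i, ‖∑ a, ∑ a', f a a' * lam i a' a‖ ^ 2
      = d * ∑ a, ∑ a', ‖f a a'‖ ^ 2 - ‖∑ a, f a a‖ ^ 2 := h f

lemma HasParseval.two (h : HasParseval lam) (f : Fin d → Fin d → Fin d → Fin d → ℂ) :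
    ∑ i, ∑ j, ‖∑ a, ∑ a', (∑ b, ∑ b', f a a' b b' * lam j b' b) * lam i a' a‖ ^ 2
      = d ^ 2 * ∑ a, ∑ a', ∑ b, ∑ b', ‖f a a' b b'‖ ^ 2
        - d * ∑ a, ∑ a', ‖∑ b, f a a' b b‖ ^ 2
        - d * ∑ b, ∑ b', ‖∑ a, f a a b b'‖ ^ 2
        + ‖∑ a, ∑ b, f a a b b‖ ^ 2 := by
  rw [Finset.sum_comm]
  simp_rw [h.sum_norm_sq]
  rw [Finset.sum_sub_distrib, ← Finset.mul_sum]
  have h1 : ∑ j, ∑ a, ∑ a', ‖∑ b, ∑ b', f a a' b b' * lam j b' b‖ ^ 2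
      = ∑ a, ∑ a', (d * ∑ b, ∑ b', ‖f a a' b b'‖ ^ 2 - ‖∑ b, f a a' b b‖ ^ 2) := by
    rw [Finset.sum_comm]
    refine Finset.sum_congr rfl fun a _ => ?_
    rw [Finset.sum_comm]
    exact Finset.sum_congr rfl fun a' _ => h _
  have h2 : ∀ j, ∑ a, ∑ b, ∑ b', f a a b b' * lam j b' b
      = ∑ b, ∑ b', (∑ a, f a a b b') * lam j b' b := by
    intro j
    rw [Finset.sum_comm]
    refine Finset.sum_congr rfl fun b _ => ?_
    rw [Finset.sum_comm]
    exact Finset.sum_congr rfl fun b' _ => (Finset.sum_mul _ _ _).symm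
  simp_rw [h1, h2, h.sum_norm_sq, Finset.sum_sub_distrib, ← Finset.mul_sum]
  rw [Finset.sum_comm (f := fun a b => f a a b b)]
  ring

lemma HasParseval.three (h : HasParseval lam)
    (f : Fin d → Fin d → Fin d → Fin d → Fin d → Fin d → ℂ) :
    ∑ i, ∑ j, ∑ l, ‖∑ a, ∑ a', (∑ b, ∑ b', (∑ c, ∑ c', f a a' b b' c c' * lam l c' c)
        * lam j b' b) * lam i a' a‖ ^ 2
      = d ^ 3 * ∑ a, ∑ a', ∑ b, ∑ b', ∑ c, ∑ c', ‖f a a' b b' c c'‖ ^ 2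
        - d ^ 2 * ∑ a, ∑ a', ∑ b, ∑ b', ‖∑ c, f a a' b b' c c‖ ^ 2
        - d ^ 2 * ∑ a, ∑ a', ∑ c, ∑ c', ‖∑ b, f a a' b b c c'‖ ^ 2
        - d ^ 2 * ∑ b, ∑ b', ∑ c, ∑ c', ‖∑ a, f a a b b' c c'‖ ^ 2
        + d * ∑ a, ∑ a', ‖∑ b, ∑ c, f a a' b b c c‖ ^ 2
        + d * ∑ b, ∑ b', ‖∑ a, ∑ c, f a a b b' c c‖ ^ 2
        + d * ∑ c, ∑ c', ‖∑ a, ∑ b, f a a b b c c'‖ ^ 2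
        - ‖∑ a, ∑ b, ∑ c, f a a b b c c‖ ^ 2 := by
  rw [sum_rotate_s4]
  simp_rw [h.sum_norm_sq]
  simp_rw [Finset.sum_sub_distrib, ← Finset.mul_sum]
  have h1 : ∑ j, ∑ l, ∑ a, ∑ a', ‖∑ b, ∑ b', (∑ c, ∑ c', f a a' b b' c c' * lam l c' c)
      * lam j b' b‖ ^ 2 = ∑ a, ∑ a', ∑ j, ∑ l, ‖∑ b, ∑ b',
        (∑ c, ∑ c', f a a' b b' c c' * lam l c' c) * lam j b' b‖ ^ 2 :=
    sum_swap_pairs _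
  have h2 : ∀ j l, ∑ a, ∑ b, ∑ b', (∑ c, ∑ c', f a a b b' c c' * lam l c' c) * lam j b' b
      = ∑ b, ∑ b', (∑ c, ∑ c', (∑ a, f a a b b' c c') * lam l c' c) * lam j b' b := by
    intro j l
    rw [Finset.sum_comm]
    refine Finset.sum_congr rfl fun b _ => ?_
    rw [Finset.sum_comm]
    refine Finset.sum_congr rfl fun b' _ => ?_
    rw [← Finset.sum_mul, Finset.sum_comm]
    congr 1
    refine Finset.sum_congr rfl fun c _ => ?_
    rw [Finset.sum_comm]
    exact Finset.sum_congr rfl fun c' _ => (Finset.sum_mul _ _ _).symm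
  have h3 : ∑ b, ∑ c, ∑ a, f a a b b c c = ∑ a, ∑ b, ∑ c, f a a b b c c := by
    rw [Finset.sum_comm (f := fun a b => ∑ c, f a a b b c c)]
    exact Finset.sum_congr rfl fun b _ => Finset.sum_comm
  have h4 : ∀ b b', ∑ c, ∑ a, f a a b b' c c = ∑ a, ∑ c, f a a b b' c c :=
    fun b b' => Finset.sum_comm
  have h5 : ∀ c c', ∑ b, ∑ a, f a a b b c c' = ∑ a, ∑ b, f a a b b c c' :=
    fun c c' => Finset.sum_comm
  rw [h1]
  simp_rw [h2, h.two, Finset.sum_add_distrib, Finset.sum_sub_distrib, ← Finset.mul_sum, h3, h4,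
    h5]
  ring

/-- The two reduced density matrices of a bipartite vector have the same purity. -/
lemma sum_norm_sq_reduced_comm {α β : Type*} [Fintype α] [Fintype β] (v : α → β → ℂ) :
    ∑ a, ∑ a', ‖∑ b, v a b * star (v a' b)‖ ^ 2
      = ∑ b, ∑ b', ‖∑ a, v a b * star (v a b')‖ ^ 2 := by
  have hsq : ∀ z : ℂ, ((‖z‖ ^ 2 : ℝ) : ℂ) = z * star z := fun z => by
    simpa using (Complex.mul_conj' z).symm
  apply Complex.ofReal_injective
  push_cast [-Complex.ofReal_pow]
  simp only [hsq, star_sum, Finset.sum_mul_sum, star_mul', star_star]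
  rw [sum_swap_pairs]
  refine Finset.sum_congr rfl fun b _ => Finset.sum_congr rfl fun b' _ =>
    Finset.sum_congr rfl fun a _ => Finset.sum_congr rfl fun a' _ => ?_
  ring

/-- The purity of a reduced density matrix is at least the inverse dimension. -/
lemma sq_sum_norm_sq_le {β : Type*} [Fintype β] (v : Fin d → β → ℂ) :
    (∑ a, ∑ b, ‖v a b‖ ^ 2) ^ 2 ≤ d * ∑ a, ∑ a', ‖∑ b, v a b * star (v a' b)‖ ^ 2 := by
  have h1 : ∀ a, ‖∑ b, v a b * star (v a b)‖ = ∑ b, ‖v a b‖ ^ 2 := by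
    intro a
    have : ∑ b, v a b * star (v a b) = ((∑ b, ‖v a b‖ ^ 2 : ℝ) : ℂ) := by
      push_cast
      exact Finset.sum_congr rfl fun b _ => Complex.mul_conj' _
    rw [this, Complex.norm_real, Real.norm_of_nonneg (by positivity)]
  calc (∑ a, ∑ b, ‖v a b‖ ^ 2) ^ 2
      ≤ d * ∑ a, (∑ b, ‖v a b‖ ^ 2) ^ 2 := by
        simpa using sq_sum_le_card_mul_sum_sq (s := Finset.univ) (f := fun a => ∑ b, ‖v a b‖ ^ 2)
    _ ≤ _ := by
        refine mul_le_mul_of_nonneg_left (Finset.sum_le_sum fun a _ => ?_) (by positivity)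
        rw [← h1]
        exact Finset.single_le_sum (f := fun a' => ‖∑ b, v a b * star (v a' b)‖ ^ 2)
          (fun _ _ => by positivity) (Finset.mem_univ a)

lemma trace_mul_kron3 (A B C : Matrix (Fin d) (Fin d) ℂ) :
    (ρ * kron3 A B C).trace = ∑ a, ∑ a', (∑ b, ∑ b', (∑ c, ∑ c',
      ρ (a, b, c) (a', b', c') * C c' c) * B b' b) * A a' a := by
  simp only [Matrix.trace, Matrix.diag_apply, Matrix.mul_apply, kron3, Matrix.of_apply,
    Fintype.sum_prod_type, Finset.sum_mul]
  refine Finset.sum_congr rfl fun a _ => ?_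
  have : ∀ g : Fin d → Fin d → Fin d → Fin d → Fin d → ℂ,
      ∑ b, ∑ c, ∑ a', ∑ b', ∑ c', g b c a' b' c' = ∑ a', ∑ b, ∑ b', ∑ c, ∑ c', g b c a' b' c' := by
    intro g
    rw [Finset.sum_comm (s := (Finset.univ : Finset (Fin d)))
      (f := fun a' b => ∑ b', ∑ c, ∑ c', g b c a' b' c')]
    refine Finset.sum_congr rfl fun b _ => ?_
    rw [Finset.sum_comm]
    exact Finset.sum_congr rfl fun a' _ => Finset.sum_comm
  rw [this]
  refine Finset.sum_congr rfl fun a' _ => Finset.sum_congr rfl fun b _ =>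
    Finset.sum_congr rfl fun b' _ => Finset.sum_congr rfl fun c _ =>
    Finset.sum_congr rfl fun c' _ => ?_
  ring

/-- The bound for (unnormalized) pure states. -/
lemma RABCsq_vecMulVec_le (hd : 2 ≤ d) (h : HasParseval lam) (v : Fin d × Fin d × Fin d → ℂ) :
    RABCsq lam (Matrix.vecMulVec v (star v))
      ≤ ((d : ℝ) - 1) ^ 2 * ((d : ℝ) + 2) * (∑ p, ‖v p‖ ^ 2) ^ 2 := by
  simp only [RABCsq, trace_mul_kron3, Matrix.vecMulVec_apply, Pi.star_apply]
  rw [h.three fun a a' b b' c c' => v (a, b, c) * star (v (a', b', c'))]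
  set n : ℝ := ∑ p, ‖v p‖ ^ 2 with hn
  let vA : Fin d → Fin d × Fin d → ℂ := fun a q => v (a, q.1, q.2)
  let vB : Fin d → Fin d × Fin d → ℂ := fun b q => v (q.1, b, q.2)
  let vC : Fin d → Fin d × Fin d → ℂ := fun c q => v (q.1, q.2, c)
  have nA : ∑ a, ∑ q, ‖vA a q‖ ^ 2 = n := by
    simp only [hn, vA, Fintype.sum_prod_type]
  have nB : ∑ a, ∑ q, ‖vB a q‖ ^ 2 = n := by
    simp only [hn, vB, Fintype.sum_prod_type]
    rw [Finset.sum_comm]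
  have nC : ∑ a, ∑ q, ‖vC a q‖ ^ 2 = n := by
    simp only [hn, vC, Fintype.sum_prod_type]
    rw [Finset.sum_comm]
    exact Finset.sum_congr rfl fun a _ => Finset.sum_comm
  have pA := sq_sum_norm_sq_le vA
  have pB := sq_sum_norm_sq_le vB
  have pC := sq_sum_norm_sq_le vC
  have sA := sum_norm_sq_reduced_comm vA
  have sB := sum_norm_sq_reduced_comm vB
  have sC := sum_norm_sq_reduced_comm vC
  rw [nA] at pA
  rw [nB] at pB
  rw [nC] at pC
  have hcomm : ∀ g : Fin d → Fin d → Fin d → Fin d → ℝ,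
      ∑ a, ∑ b, ∑ a', ∑ b', g a a' b b' = ∑ a, ∑ a', ∑ b, ∑ b', g a a' b b' :=
    fun g => Finset.sum_congr rfl fun a _ => Finset.sum_comm
  simp only [Fintype.sum_prod_type, vA, vB, vC] at pA pB pC sA sB sC
  rw [hcomm fun b b' c c' => ‖∑ a, v (a, b, c) * star (v (a, b', c'))‖ ^ 2] at sA
  rw [hcomm fun a a' c c' => ‖∑ b, v (a, b, c) * star (v (a', b, c'))‖ ^ 2] at sB
  rw [hcomm fun a a' b b' => ‖∑ c, v (a, b, c) * star (v (a', b', c))‖ ^ 2] at sC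
  have hfull : ∑ a, ∑ a', ∑ b, ∑ b', ∑ c, ∑ c', ‖v (a, b, c) * star (v (a', b', c'))‖ ^ 2
      = n ^ 2 := by
    have hprod : n ^ 2 = ∑ p, ∑ q, ‖v p * star (v q)‖ ^ 2 := by
      rw [sq, hn, Finset.sum_mul_sum]
      simp [mul_pow]
    rw [hprod]
    simp only [Fintype.sum_prod_type]
    refine Finset.sum_congr rfl fun a _ => ?_
    have : ∀ g : Fin d → Fin d → Fin d → Fin d → Fin d → ℝ,
        ∑ a', ∑ b, ∑ b', ∑ c, ∑ c', g a' b b' c c'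
          = ∑ b, ∑ c, ∑ a', ∑ b', ∑ c', g a' b b' c c' := by
      intro g
      rw [Finset.sum_comm]
      refine Finset.sum_congr rfl fun b _ => ?_
      rw [Finset.sum_comm (f := fun c a' => ∑ b', ∑ c', g a' b b' c c')]
      exact Finset.sum_congr rfl fun a' _ => Finset.sum_comm
    exact this _
  have htrace : ‖∑ a, ∑ b, ∑ c, v (a, b, c) * star (v (a, b, c))‖ ^ 2 = n ^ 2 := by
    have : ∑ a, ∑ b, ∑ c, v (a, b, c) * star (v (a, b, c)) = (n : ℂ) := by
      rw [hn]
      push_cast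
      simp only [Fintype.sum_prod_type]
      refine Finset.sum_congr rfl fun a _ => Finset.sum_congr rfl fun b _ =>
        Finset.sum_congr rfl fun c _ => Complex.mul_conj' _
    rw [this, Complex.norm_real, Real.norm_eq_abs, sq_abs]
  rw [hfull, htrace, ← sA, ← sB, ← sC]
  have hd' : (0 : ℝ) ≤ (d : ℝ) - 1 := by
    have : (2 : ℝ) ≤ d := by exact_mod_cast hd
    linarith
  have qA := mul_le_mul_of_nonneg_left pA hd'
  have qB := mul_le_mul_of_nonneg_left pB hd'
  have qC := mul_le_mul_of_nonneg_left pC hd'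
  linarith

/-- The square root of `RABCsq` is subadditive. -/
lemma sqrt_RABCsq_sum_le {κ : Type*} (s : Finset κ)
    (σ : κ → Matrix (Fin d × Fin d × Fin d) (Fin d × Fin d × Fin d) ℂ) :
    √(RABCsq lam (∑ k ∈ s, σ k)) ≤ ∑ k ∈ s, √(RABCsq lam (σ k)) := by
  let T : Matrix (Fin d × Fin d × Fin d) (Fin d × Fin d × Fin d) ℂ →
      EuclideanSpace ℂ (Fin (d ^ 2 - 1) × Fin (d ^ 2 - 1) × Fin (d ^ 2 - 1)) :=
    fun τ => WithLp.toLp 2 fun x => (τ * kron3 (lam x.1) (lam x.2.1) (lam x.2.2)).trace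
  have hT : ∀ τ, √(RABCsq lam τ) = ‖T τ‖ := by
    intro τ
    simp [EuclideanSpace.norm_eq, RABCsq, T, Fintype.sum_prod_type]
  have hsum : T (∑ k ∈ s, σ k) = ∑ k ∈ s, T (σ k) := by
    ext x
    simp [T, Finset.sum_mul, Matrix.trace_sum]
  simp only [hT, hsum]
  exact norm_sum_le _ _

/-- Corollary 2.2: for any tripartite qudit state, `‖R^{ABC}‖² ≤ (d-1)²(d+2)`. -/
theorem tripartite_correlation_tensor_bound (d : ℕ) (hd : 2 ≤ d)
    (lam : Fin (d ^ 2 - 1) → Matrix (Fin d) (Fin d) ℂ)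
    (hherm : ∀ i, (lam i).IsHermitian)
    (htr0 : ∀ i, (lam i).trace = 0)
    (horth : ∀ i j, (lam i * lam j).trace = if i = j then (d : ℂ) else 0)
    (ρ : Matrix (Fin d × Fin d × Fin d) (Fin d × Fin d × Fin d) ℂ)
    (hpsd : ρ.PosSemidef) (htr1 : ρ.trace = 1) :
    RABCsq lam ρ ≤ ((d : ℝ) - 1) ^ 2 * ((d : ℝ) + 2) := by
  obtain ⟨m, v, hρ⟩ := Matrix.posSemidef_iff_eq_sum_vecMulVec.1 hpsd
  have hn : ∑ k, ∑ p, ‖v k p‖ ^ 2 = 1 := by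
    apply Complex.ofReal_injective
    push_cast
    rw [← htr1, hρ, Matrix.trace_sum]
    simp only [Matrix.trace, Matrix.diag_apply, Matrix.vecMulVec_apply, Pi.star_apply]
    exact Finset.sum_congr rfl fun k _ => Finset.sum_congr rfl fun p _ =>
      (Complex.mul_conj' (v k p)).symm
  have hC : 0 ≤ ((d : ℝ) - 1) ^ 2 * ((d : ℝ) + 2) := by positivity
  have h := hasParseval lam hd hherm htr0 horth
  rw [← Real.sqrt_le_sqrt_iff hC]
  calc √(RABCsq lam ρ)
      ≤ ∑ k, √(RABCsq lam (Matrix.vecMulVec (v k) (star (v k)))) := by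
        conv_lhs => rw [hρ]
        exact sqrt_RABCsq_sum_le _ _
    _ ≤ ∑ k, √(((d : ℝ) - 1) ^ 2 * ((d : ℝ) + 2)) * ∑ p, ‖v k p‖ ^ 2 := by
        refine Finset.sum_le_sum fun k _ => ?_
        refine (Real.sqrt_le_sqrt (RABCsq_vecMulVec_le hd h _)).trans_eq ?_
        rw [Real.sqrt_mul hC, Real.sqrt_sq (by positivity)]
    _ = √(((d : ℝ) - 1) ^ 2 * ((d : ℝ) + 2)) := by
        rw [← Finset.mul_sum, hn, mul_one]

end SpinCorr3
end

section
/- (Theorem 2.3) Let ρ be a pure tripartite qudit state on ℂ^d ⊗ ℂ^d ⊗ ℂ^d. Then the sum of the three isotropic strengths satisfies the trade-off relation s_iso^{AB} + s_iso^{AC} + s_iso^{BC} = d − 1 − ((d−2)/((d+1)(d−1)²))·‖R^{ABC}‖². -/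
open Matrix ComplexOrder

namespace SpinCorr3

variable {d : ℕ}

variable (lam : Fin (d ^ 2 - 1) → Matrix (Fin d) (Fin d) ℂ)
variable (ρ : Matrix (Fin d × Fin d × Fin d) (Fin d × Fin d × Fin d) ℂ)

/-- An idempotent matrix of trace one has rank one, so its `2 × 2` minors vanish. -/
theorem exchange_of_idempotent_trace_one {n : Type*} [Fintype n] [DecidableEq n]
    {ρ : Matrix n n ℂ} (htr : ρ.trace = 1) (hidem : ρ * ρ = ρ) (p q r s : n) :
    ρ p q * ρ r s = ρ p s * ρ r q := by
  have hid : IsIdempotentElem (Matrix.toLin' ρ) := by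
    rw [IsIdempotentElem, Module.End.mul_eq_comp, ← Matrix.toLin'_mul, hidem]
  have hrank : Module.finrank ℂ (LinearMap.range (Matrix.toLin' ρ)) = 1 := by
    have h := (LinearMap.IsIdempotentElem.isProj_range _ hid).trace
    rw [Matrix.trace_toLin'_eq, htr] at h
    exact_mod_cast h.symm
  obtain ⟨v, -, hv⟩ := finrank_eq_one_iff'.mp hrank
  have hcol (q : n) : ∃ c : ℂ, ∀ p, ρ p q = c * (v : n → ℂ) p := by
    obtain ⟨c, hc⟩ := hv ⟨_, LinearMap.mem_range_self (Matrix.toLin' ρ) (Pi.single q 1)⟩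
    refine ⟨c, fun p => ?_⟩
    have := congrFun (congrArg Subtype.val hc) p
    simpa using this.symm
  obtain ⟨c, hc⟩ := hcol q
  obtain ⟨e, he⟩ := hcol s
  rw [hc, hc, he, he]
  ring

/-- The coefficient tensor of the identity on two copies of `ℂ^d`. -/
def idKernel (i j k l : Fin d) : ℂ := (1 : Matrix (Fin d) (Fin d) ℂ) i j * (1 : Matrix _ _ ℂ) k l

/-- The coefficient tensor of the swap operator on two copies of `ℂ^d`. -/
def swapKernel (i j k l : Fin d) : ℂ := idKernel i l k j

/-- The quantity `tr((ρ ⊗ ρ) (f₁ ⊗ f₂ ⊗ f₃))`, where `fₖ` acts on the two copies of party `k`. -/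
def twoCopy (ρ : Matrix (Fin d × Fin d × Fin d) (Fin d × Fin d × Fin d) ℂ)
    (f₁ f₂ f₃ : Fin d → Fin d → Fin d → Fin d → ℂ) : ℂ :=
  ∑ p, ∑ q, ∑ r, ∑ s, ρ p q * ρ r s *
    (f₁ q.1 p.1 s.1 r.1 * f₂ q.2.1 p.2.1 s.2.1 r.2.1 * f₃ q.2.2 p.2.2 s.2.2 r.2.2)

/-- Completeness relation of a traceless orthogonal family of `d ^ 2 - 1` matrices. -/
theorem sum_mul_eq_swapKernel_sub_idKernel (hd : 0 < d)
    {lam : Fin (d ^ 2 - 1) → Matrix (Fin d) (Fin d) ℂ}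
    (htr0 : ∀ i, (lam i).trace = 0)
    (horth : ∀ i j, (lam i * lam j).trace = if i = j then (d : ℂ) else 0) (i j k l : Fin d) :
    ∑ a, lam a i j * lam a k l = d * swapKernel i j k l - idKernel i j k l := by
  have hd' : (d : ℂ) ≠ 0 := by exact_mod_cast hd.ne'
  let u : Option (Fin (d ^ 2 - 1)) → Matrix (Fin d) (Fin d) ℂ := fun o => o.elim 1 lam
  have hu (a b) : (u a * u b).trace = if a = b then (d : ℂ) else 0 := by
    cases a <;> cases b <;> simp [u, htr0, horth]
  let M : Matrix (Option (Fin (d ^ 2 - 1))) (Fin d × Fin d) ℂ := .of fun a x => u a x.1 x.2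
  let N : Matrix (Fin d × Fin d) (Option (Fin (d ^ 2 - 1))) ℂ :=
    .of fun x a => (d : ℂ)⁻¹ * u a x.2 x.1
  have hMN : M * N = 1 := by
    ext a b
    have h : (M * N) a b = (d : ℂ)⁻¹ * (u a * u b).trace := by
      simp only [M, N, Matrix.mul_apply, Matrix.trace, Matrix.diag, Matrix.of_apply,
        Fintype.sum_prod_type, Finset.mul_sum]
      exact Finset.sum_congr rfl fun _ _ => Finset.sum_congr rfl fun _ _ => by ring
    rw [h, hu, Matrix.one_apply]
    split_ifs <;> simp [hd']
  have hcard : Fintype.card (Option (Fin (d ^ 2 - 1))) = Fintype.card (Fin d × Fin d) := by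
    have : 0 < d ^ 2 := by positivity
    simp only [Fintype.card_option, Fintype.card_fin, Fintype.card_prod]
    rw [Nat.sub_add_cancel this, sq]
  have hNM := (Matrix.mul_eq_one_comm_of_card_eq _ _ _ hcard).mp hMN
  have h := congrFun (congrFun hNM (j, i)) (k, l)
  simp only [M, N, Matrix.mul_apply, Matrix.of_apply, Fintype.sum_option, u, Option.elim_none,
    Option.elim_some, mul_assoc, ← Finset.mul_sum] at h
  rw [inv_mul_eq_iff_eq_mul₀ hd'] at h
  rw [swapKernel, idKernel, idKernel, eq_sub_iff_add_eq', h]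
  congr 1
  clear h
  simp only [Matrix.one_apply, Prod.mk.injEq, eq_comm (a := j), ← ite_and, ite_mul, one_mul,
    zero_mul, and_comm]

theorem trace_mul_kron3_sq (ρ : Matrix (Fin d × Fin d × Fin d) (Fin d × Fin d × Fin d) ℂ)
    (A B C : Matrix (Fin d) (Fin d) ℂ) :
    (ρ * kron3 A B C).trace ^ 2 = twoCopy ρ (fun i j k l => A i j * A k l)
      (fun i j k l => B i j * B k l) (fun i j k l => C i j * C k l) := by
  have h : (ρ * kron3 A B C).trace =
      ∑ p, ∑ q, ρ p q * (A q.1 p.1 * B q.2.1 p.2.1 * C q.2.2 p.2.2) := by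
    simp only [Matrix.trace, Matrix.diag, Matrix.mul_apply, kron3, Matrix.of_apply]
  rw [h, sq, twoCopy]
  simp only [Finset.sum_mul]
  refine Finset.sum_congr rfl fun p _ => Finset.sum_congr rfl fun q _ => ?_
  simp only [Finset.mul_sum]
  exact Finset.sum_congr rfl fun r _ => Finset.sum_congr rfl fun s _ => by ring

theorem conj_trace_mul_kron3 {ρ : Matrix (Fin d × Fin d × Fin d) (Fin d × Fin d × Fin d) ℂ}
    (hρ : ρ.IsHermitian) {A B C : Matrix (Fin d) (Fin d) ℂ}
    (hA : A.IsHermitian) (hB : B.IsHermitian) (hC : C.IsHermitian) :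
    star (ρ * kron3 A B C).trace = (ρ * kron3 A B C).trace := by
  have hK : (kron3 A B C).IsHermitian := by
    ext p q
    simp only [Matrix.conjTranspose_apply, kron3, Matrix.of_apply, star_mul', hA.apply, hB.apply,
      hC.apply]
  rw [← Matrix.trace_conjTranspose, Matrix.conjTranspose_mul, hK.eq, hρ.eq, Matrix.trace_mul_comm]

theorem norm_trace_mul_kron3_sq
    {ρ : Matrix (Fin d × Fin d × Fin d) (Fin d × Fin d × Fin d) ℂ}
    (hρ : ρ.IsHermitian) {A B C : Matrix (Fin d) (Fin d) ℂ}
    (hA : A.IsHermitian) (hB : B.IsHermitian) (hC : C.IsHermitian) :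
    ((‖(ρ * kron3 A B C).trace‖ : ℂ)) ^ 2 = twoCopy ρ (fun i j k l => A i j * A k l)
      (fun i j k l => B i j * B k l) (fun i j k l => C i j * C k l) := by
  rw [← trace_mul_kron3_sq, ← Complex.mul_conj', starRingEnd_apply,
    conj_trace_mul_kron3 hρ hA hB hC, sq]

section Linearity

variable (f g f₁ f₂ f₃ : Fin d → Fin d → Fin d → Fin d → ℂ) (c : ℂ)

theorem twoCopy_smul_sub_left :
    twoCopy ρ (fun i j k l => c * f i j k l - g i j k l) f₂ f₃ =
      c * twoCopy ρ f f₂ f₃ - twoCopy ρ g f₂ f₃ := by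
  simp only [twoCopy, Finset.mul_sum, ← Finset.sum_sub_distrib]
  refine Finset.sum_congr rfl fun _ _ => Finset.sum_congr rfl fun _ _ =>
    Finset.sum_congr rfl fun _ _ => Finset.sum_congr rfl fun _ _ => ?_
  ring

theorem twoCopy_smul_sub_middle :
    twoCopy ρ f₁ (fun i j k l => c * f i j k l - g i j k l) f₃ =
      c * twoCopy ρ f₁ f f₃ - twoCopy ρ f₁ g f₃ := by
  simp only [twoCopy, Finset.mul_sum, ← Finset.sum_sub_distrib]
  refine Finset.sum_congr rfl fun _ _ => Finset.sum_congr rfl fun _ _ =>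
    Finset.sum_congr rfl fun _ _ => Finset.sum_congr rfl fun _ _ => ?_
  ring

theorem twoCopy_smul_sub_right :
    twoCopy ρ f₁ f₂ (fun i j k l => c * f i j k l - g i j k l) =
      c * twoCopy ρ f₁ f₂ f - twoCopy ρ f₁ f₂ g := by
  simp only [twoCopy, Finset.mul_sum, ← Finset.sum_sub_distrib]
  refine Finset.sum_congr rfl fun _ _ => Finset.sum_congr rfl fun _ _ =>
    Finset.sum_congr rfl fun _ _ => Finset.sum_congr rfl fun _ _ => ?_
  ring

theorem sum_twoCopy_left {ι : Type*} [Fintype ι] (F : ι → Fin d → Fin d → Fin d → Fin d → ℂ) :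
    ∑ a, twoCopy ρ (F a) f₂ f₃ = twoCopy ρ (fun i j k l => ∑ a, F a i j k l) f₂ f₃ := by
  simp only [twoCopy, Finset.sum_mul, Finset.mul_sum]
  rw [Finset.sum_comm]; congr! 2
  rw [Finset.sum_comm]; congr! 2
  rw [Finset.sum_comm]; congr! 2
  rw [Finset.sum_comm]

theorem sum_twoCopy_middle {ι : Type*} [Fintype ι] (F : ι → Fin d → Fin d → Fin d → Fin d → ℂ) :
    ∑ a, twoCopy ρ f₁ (F a) f₃ = twoCopy ρ f₁ (fun i j k l => ∑ a, F a i j k l) f₃ := by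
  simp only [twoCopy, Finset.sum_mul, Finset.mul_sum]
  rw [Finset.sum_comm]; congr! 2
  rw [Finset.sum_comm]; congr! 2
  rw [Finset.sum_comm]; congr! 2
  rw [Finset.sum_comm]

theorem sum_twoCopy_right {ι : Type*} [Fintype ι] (F : ι → Fin d → Fin d → Fin d → Fin d → ℂ) :
    ∑ a, twoCopy ρ f₁ f₂ (F a) = twoCopy ρ f₁ f₂ (fun i j k l => ∑ a, F a i j k l) := by
  simp only [twoCopy, Finset.mul_sum]
  rw [Finset.sum_comm]; congr! 2
  rw [Finset.sum_comm]; congr! 2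
  rw [Finset.sum_comm]; congr! 2
  rw [Finset.sum_comm]

end Linearity

/-- For a pure state, exchanging the column indices of the two copies leaves `twoCopy` invariant. -/
theorem twoCopy_exchange {ρ : Matrix (Fin d × Fin d × Fin d) (Fin d × Fin d × Fin d) ℂ}
    (htr1 : ρ.trace = 1) (hpure : ρ * ρ = ρ) (f₁ f₂ f₃ : Fin d → Fin d → Fin d → Fin d → ℂ) :
    twoCopy ρ f₁ f₂ f₃ = twoCopy ρ (fun i j k l => f₁ k j i l) (fun i j k l => f₂ k j i l)
      (fun i j k l => f₃ k j i l) := by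
  unfold twoCopy
  refine Finset.sum_congr rfl fun p _ => ?_
  rw [Finset.sum_congr rfl fun q _ => Finset.sum_comm, Finset.sum_comm]
  refine Finset.sum_congr rfl fun s _ => ?_
  rw [Finset.sum_comm]
  refine Finset.sum_congr rfl fun r _ => Finset.sum_congr rfl fun q _ => ?_
  rw [exchange_of_idempotent_trace_one htr1 hpure p q r s]

theorem swapKernel_exchange :
    (fun i j k l : Fin d => swapKernel k j i l) = idKernel := by
  funext i j k l
  simp only [swapKernel, idKernel, mul_comm]

theorem idKernel_exchange :
    (fun i j k l : Fin d => idKernel k j i l) = swapKernel := by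
  funext i j k l
  simp only [swapKernel, idKernel, mul_comm]

theorem twoCopy_idKernel (ρ : Matrix (Fin d × Fin d × Fin d) (Fin d × Fin d × Fin d) ℂ) :
    twoCopy ρ idKernel idKernel idKernel = ρ.trace ^ 2 := by
  have h : kron3 (1 : Matrix (Fin d) (Fin d) ℂ) 1 1 = 1 := by
    ext ⟨p₁, p₂, p₃⟩ ⟨q₁, q₂, q₃⟩
    simp only [kron3, Matrix.of_apply, Matrix.one_apply, Prod.mk.injEq]
    split_ifs <;> simp_all
  have := trace_mul_kron3_sq ρ 1 1 1
  rw [h, mul_one] at this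
  exact this.symm

/-- Theorem 2.3: trade-off relation for the isotropic strengths of a pure
tripartite qudit state. -/
theorem isotropic_strength_tradeoff_pure_tripartite (d : ℕ) (hd : 2 ≤ d)
    (lam : Fin (d ^ 2 - 1) → Matrix (Fin d) (Fin d) ℂ)
    (hherm : ∀ i, (lam i).IsHermitian)
    (htr0 : ∀ i, (lam i).trace = 0)
    (horth : ∀ i j, (lam i * lam j).trace = if i = j then (d : ℂ) else 0)
    (ρ : Matrix (Fin d × Fin d × Fin d) (Fin d × Fin d × Fin d) ℂ)
    (hpsd : ρ.PosSemidef) (htr1 : ρ.trace = 1) (hpure : ρ * ρ = ρ) :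
    sAB lam ρ + sAC lam ρ + sBC lam ρ =
      (d : ℝ) - 1 - ((d : ℝ) - 2) / (((d : ℝ) + 1) * ((d : ℝ) - 1) ^ 2) * RABCsq lam ρ := by
  have hρ := hpsd.isHermitian
  have h1 : (1 : Matrix (Fin d) (Fin d) ℂ).IsHermitian := Matrix.isHermitian_one
  have hsum := sum_mul_eq_swapKernel_sub_idKernel (by lia) htr0 horth
  have hone : (fun i j k l : Fin d => (1 : Matrix (Fin d) (Fin d) ℂ) i j *
      (1 : Matrix (Fin d) (Fin d) ℂ) k l) = idKernel := rfl
  have hex (f₁ f₂ f₃) := twoCopy_exchange htr1 hpure f₁ f₂ f₃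
  have hiii : twoCopy ρ idKernel idKernel idKernel = 1 := by rw [twoCopy_idKernel, htr1, one_pow]
  have hsss := hex swapKernel swapKernel swapKernel
  have hssi := hex swapKernel swapKernel idKernel
  have hsis := hex swapKernel idKernel swapKernel
  have hiss := hex idKernel swapKernel swapKernel
  simp only [swapKernel_exchange, idKernel_exchange] at hsss hssi hsis hiss
  have hAB : (RABsq lam ρ : ℂ) = d ^ 2 * twoCopy ρ swapKernel swapKernel idKernel
      - d * twoCopy ρ swapKernel idKernel idKernel
      - d * twoCopy ρ idKernel swapKernel idKernel + 1 := by
    simp only [RABsq, Complex.ofReal_sum, Complex.ofReal_pow, norm_trace_mul_kron3_sq hρ,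
      hherm, h1, sum_twoCopy_left, sum_twoCopy_middle]
    simp only [hsum, hone, twoCopy_smul_sub_left, twoCopy_smul_sub_middle,
      hiii]
    ring
  have hAC : (RACsq lam ρ : ℂ) = d ^ 2 * twoCopy ρ swapKernel idKernel swapKernel
      - d * twoCopy ρ swapKernel idKernel idKernel
      - d * twoCopy ρ idKernel idKernel swapKernel + 1 := by
    simp only [RACsq, Complex.ofReal_sum, Complex.ofReal_pow, norm_trace_mul_kron3_sq hρ,
      hherm, h1, sum_twoCopy_left, sum_twoCopy_right]
    simp only [hsum, hone, twoCopy_smul_sub_left, twoCopy_smul_sub_right,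
      hiii]
    ring
  have hBC : (RBCsq lam ρ : ℂ) = d ^ 2 * twoCopy ρ idKernel swapKernel swapKernel
      - d * twoCopy ρ idKernel swapKernel idKernel
      - d * twoCopy ρ idKernel idKernel swapKernel + 1 := by
    simp only [RBCsq, Complex.ofReal_sum, Complex.ofReal_pow, norm_trace_mul_kron3_sq hρ,
      hherm, h1, sum_twoCopy_middle, sum_twoCopy_right]
    simp only [hsum, hone, twoCopy_smul_sub_middle, twoCopy_smul_sub_right,
      hiii]
    ring
  have hABC : (RABCsq lam ρ : ℂ) = d ^ 3 - d ^ 2 * (twoCopy ρ swapKernel swapKernel idKernel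
        + twoCopy ρ swapKernel idKernel swapKernel + twoCopy ρ idKernel swapKernel swapKernel)
      + d * (twoCopy ρ swapKernel idKernel idKernel + twoCopy ρ idKernel swapKernel idKernel
        + twoCopy ρ idKernel idKernel swapKernel) - 1 := by
    simp only [RABCsq, Complex.ofReal_sum, Complex.ofReal_pow, norm_trace_mul_kron3_sq hρ,
      hherm, sum_twoCopy_left, sum_twoCopy_middle, sum_twoCopy_right]
    simp only [hsum, twoCopy_smul_sub_left, twoCopy_smul_sub_middle, twoCopy_smul_sub_right,
      hiii, hsss]
    ring
  have key : ((d : ℝ) - 1) * (RABsq lam ρ + RACsq lam ρ + RBCsq lam ρ) =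
      ((d : ℝ) - 1) ^ 3 * (d + 1) - ((d : ℝ) - 2) * RABCsq lam ρ := by
    have : ((d : ℂ) - 1) * (RABsq lam ρ + RACsq lam ρ + RBCsq lam ρ) =
        ((d : ℂ) - 1) ^ 3 * (d + 1) - ((d : ℂ) - 2) * RABCsq lam ρ := by
      rw [hAB, hAC, hBC, hABC, hssi, hsis, hiss]
      ring
    exact_mod_cast this
  have hd2 : (2 : ℝ) ≤ d := by exact_mod_cast hd
  have hm : (d : ℝ) - 1 ≠ 0 := by linarith
  have hp : (d : ℝ) + 1 ≠ 0 := by linarith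
  have hsq : (d : ℝ) ^ 2 - 1 = (d + 1) * (d - 1) := by ring
  rw [sAB, sAC, sBC, hsq]
  field_simp
  linear_combination key

end SpinCorr3
end

section
/- Let ρ be a pure quadripartite qudit state on ℂ^d ⊗ ℂ^d ⊗ ℂ^d ⊗ ℂ^d. Then the differences of isotropic strengths of complementary pairs satisfy s_iso^{AB} − s_iso^{CD} = (−(‖a‖² + ‖b‖²) + ‖c‖² + ‖d‖²)/(d²−1), s_iso^{AC} − s_iso^{BD} = (−(‖a‖² + ‖c‖²) + ‖b‖² + ‖d‖²)/(d²−1), and s_iso^{AD} − s_iso^{BC} = (−(‖a‖² + ‖d‖²) + ‖b‖² + ‖c‖²)/(d²−1). -/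
open Matrix ComplexOrder

namespace SpinCorr4

variable {d : ℕ}

/-- Tensor (Kronecker) product of four `d × d` matrices, acting on `(ℂ^d)^{⊗4}`. -/
noncomputable def kron4 (A B C D : Matrix (Fin d) (Fin d) ℂ) :
    Matrix (Fin d × Fin d × Fin d × Fin d) (Fin d × Fin d × Fin d × Fin d) ℂ :=
  Matrix.of fun p q =>
    A p.1 q.1 * B p.2.1 q.2.1 * C p.2.2.1 q.2.2.1 * D p.2.2.2 q.2.2.2

variable (lam : Fin (d ^ 2 - 1) → Matrix (Fin d) (Fin d) ℂ)
variable (ρ : Matrix (Fin d × Fin d × Fin d × Fin d) (Fin d × Fin d × Fin d × Fin d) ℂ)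

/-- `‖a‖²`, the squared Euclidean norm of the Bloch vector of party A. -/
noncomputable def aSq : ℝ := ∑ i, ‖(ρ * kron4 (lam i) 1 1 1).trace‖ ^ 2

/-- `‖b‖²`. -/
noncomputable def bSq : ℝ := ∑ i, ‖(ρ * kron4 1 (lam i) 1 1).trace‖ ^ 2

/-- `‖c‖²`. -/
noncomputable def cSq : ℝ := ∑ i, ‖(ρ * kron4 1 1 (lam i) 1).trace‖ ^ 2

/-- `‖d‖²`. -/
noncomputable def dSq : ℝ := ∑ i, ‖(ρ * kron4 1 1 1 (lam i)).trace‖ ^ 2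

/-- `‖R^{AB}‖²`, squared Frobenius norm of the spin correlation matrix of parties A,B. -/
noncomputable def RABsq : ℝ := ∑ i, ∑ j, ‖(ρ * kron4 (lam i) (lam j) 1 1).trace‖ ^ 2

/-- `‖R^{AC}‖²`. -/
noncomputable def RACsq : ℝ := ∑ i, ∑ j, ‖(ρ * kron4 (lam i) 1 (lam j) 1).trace‖ ^ 2

/-- `‖R^{AD}‖²`. -/
noncomputable def RADsq : ℝ := ∑ i, ∑ j, ‖(ρ * kron4 (lam i) 1 1 (lam j)).trace‖ ^ 2

/-- `‖R^{BC}‖²`. -/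
noncomputable def RBCsq : ℝ := ∑ i, ∑ j, ‖(ρ * kron4 1 (lam i) (lam j) 1).trace‖ ^ 2

/-- `‖R^{BD}‖²`. -/
noncomputable def RBDsq : ℝ := ∑ i, ∑ j, ‖(ρ * kron4 1 (lam i) 1 (lam j)).trace‖ ^ 2

/-- `‖R^{CD}‖²`. -/
noncomputable def RCDsq : ℝ := ∑ i, ∑ j, ‖(ρ * kron4 1 1 (lam i) (lam j)).trace‖ ^ 2

/-- `‖R^{ABC}‖²`, squared Euclidean norm of the three-body correlation tensor of A,B,C. -/
noncomputable def RABCsq : ℝ :=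
  ∑ i, ∑ j, ∑ l, ‖(ρ * kron4 (lam i) (lam j) (lam l) 1).trace‖ ^ 2

/-- `‖R^{ABD}‖²`. -/
noncomputable def RABDsq : ℝ :=
  ∑ i, ∑ j, ∑ l, ‖(ρ * kron4 (lam i) (lam j) 1 (lam l)).trace‖ ^ 2

/-- `‖R^{ACD}‖²`. -/
noncomputable def RACDsq : ℝ :=
  ∑ i, ∑ j, ∑ l, ‖(ρ * kron4 (lam i) 1 (lam j) (lam l)).trace‖ ^ 2

/-- `‖R^{BCD}‖²`. -/
noncomputable def RBCDsq : ℝ :=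
  ∑ i, ∑ j, ∑ l, ‖(ρ * kron4 1 (lam i) (lam j) (lam l)).trace‖ ^ 2

/-- `‖R^{ABCD}‖²`, squared Euclidean norm of the four-body correlation tensor. -/
noncomputable def RABCDsq : ℝ :=
  ∑ i, ∑ j, ∑ l, ∑ m, ‖(ρ * kron4 (lam i) (lam j) (lam l) (lam m)).trace‖ ^ 2

/-- Isotropic strength `s_iso^{AB} = ‖R^{AB}‖²/(d²-1)`. -/
noncomputable def sAB : ℝ := RABsq lam ρ / ((d : ℝ) ^ 2 - 1)

/-- `s_iso^{AC}`. -/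
noncomputable def sAC : ℝ := RACsq lam ρ / ((d : ℝ) ^ 2 - 1)

/-- `s_iso^{AD}`. -/
noncomputable def sAD : ℝ := RADsq lam ρ / ((d : ℝ) ^ 2 - 1)

/-- `s_iso^{BC}`. -/
noncomputable def sBC : ℝ := RBCsq lam ρ / ((d : ℝ) ^ 2 - 1)

/-- `s_iso^{BD}`. -/
noncomputable def sBD : ℝ := RBDsq lam ρ / ((d : ℝ) ^ 2 - 1)

/-- `s_iso^{CD}`. -/
noncomputable def sCD : ℝ := RCDsq lam ρ / ((d : ℝ) ^ 2 - 1)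

/-- A trace-one idempotent matrix has rank one, so column indices may be exchanged in products of
entries. -/
lemma mul_entries_swap {n : Type*} [Fintype n] [DecidableEq n] {P : Matrix n n ℂ}
    (htr : P.trace = 1) (hP : P * P = P) (i j k l : n) :
    P i j * P k l = P i l * P k j := by
  have hid : IsIdempotentElem (Matrix.toLin' P) := by
    rw [IsIdempotentElem, Module.End.mul_eq_comp, ← Matrix.toLin'_mul, hP]
  have h1 : Module.finrank ℂ (LinearMap.range (Matrix.toLin' P)) = 1 := by
    have h := (LinearMap.IsIdempotentElem.isProj_range _ hid).trace
    rw [Matrix.trace_toLin'_eq, htr] at h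
    exact_mod_cast h.symm
  obtain ⟨v, -, hv⟩ := finrank_eq_one_iff'.mp h1
  have hcol : ∀ j, ∃ c : ℂ, ∀ i, P i j = c * (v : n → ℂ) i := by
    intro j
    obtain ⟨c, hc⟩ := hv ⟨Matrix.toLin' P (Pi.single j 1), LinearMap.mem_range_self _ _⟩
    refine ⟨c, fun i => ?_⟩
    have := congrFun (congrArg Subtype.val hc) i
    simpa using this.symm
  choose c hc using hcol
  rw [hc, hc, hc, hc]
  ring

/-- The two marginals of a pure bipartite state have equal purity. -/
lemma marginal_purity_eq {X Y : Type*} [Fintype X] [Fintype Y] [DecidableEq X] [DecidableEq Y]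
    {P : Matrix (X × Y) (X × Y) ℂ} (hH : P.IsHermitian) (htr : P.trace = 1) (hP : P * P = P) :
    ∑ x, ∑ x', ‖∑ y, P (x, y) (x', y)‖ ^ 2 = ∑ y, ∑ y', ‖∑ x, P (x, y) (x, y')‖ ^ 2 := by
  have hX : ∀ x x', ((‖∑ y, P (x, y) (x', y)‖ ^ 2 : ℝ) : ℂ) =
      ∑ y, ∑ y', P (x, y) (x', y) * P (x', y') (x, y') := by
    intro x x'
    rw [Complex.ofReal_pow, ← Complex.mul_conj', map_sum, Finset.sum_mul_sum]
    refine Finset.sum_congr rfl fun y _ => Finset.sum_congr rfl fun y' _ => ?_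
    rw [← hH.apply (x', y') (x, y')]; rfl
  have hY : ∀ y y', ((‖∑ x, P (x, y) (x, y')‖ ^ 2 : ℝ) : ℂ) =
      ∑ x, ∑ x', P (x, y) (x', y) * P (x', y') (x, y') := by
    intro y y'
    rw [Complex.ofReal_pow, ← Complex.mul_conj', map_sum, Finset.sum_mul_sum]
    refine Finset.sum_congr rfl fun x _ => Finset.sum_congr rfl fun x' _ => ?_
    rw [mul_entries_swap htr hP (x, y) (x', y), ← hH.apply (x', y') (x', y)]; rfl
  apply Complex.ofReal_injective
  simp only [Complex.ofReal_sum, hX, hY]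
  calc _ = ∑ x, ∑ y, ∑ x', ∑ y', P (x, y) (x', y) * P (x', y') (x, y') :=
        Finset.sum_congr rfl fun x _ => Finset.sum_comm
    _ = ∑ y, ∑ x, ∑ x', ∑ y', P (x, y) (x', y) * P (x', y') (x, y') := Finset.sum_comm
    _ = ∑ y, ∑ x, ∑ y', ∑ x', P (x, y) (x', y) * P (x', y') (x, y') :=
        Finset.sum_congr rfl fun y _ => Finset.sum_congr rfl fun x _ => Finset.sum_comm
    _ = _ := Finset.sum_congr rfl fun y _ => Finset.sum_comm

/-- The identity matrix adjoined to a family of `d × d` matrices. -/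
noncomputable def withOne (o : Option (Fin (d ^ 2 - 1))) : Matrix (Fin d) (Fin d) ℂ :=
  o.elim 1 lam

/-- Completeness relation of an orthogonal matrix basis. -/
lemma sum_withOne_mul_withOne {lam : Fin (d ^ 2 - 1) → Matrix (Fin d) (Fin d) ℂ} (hd : 2 ≤ d)
    (htr0 : ∀ i, (lam i).trace = 0)
    (horth : ∀ i j, (lam i * lam j).trace = if i = j then (d : ℂ) else 0)
    (p q : Fin d × Fin d) :
    ∑ o, withOne lam o p.2 p.1 * withOne lam o q.1 q.2 = if p = q then (d : ℂ) else 0 := by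
  have hd0 : (d : ℂ) ≠ 0 := by
    have : d ≠ 0 := by omega
    exact_mod_cast this
  have htr : ∀ o o', (withOne lam o * withOne lam o').trace = if o = o' then (d : ℂ) else 0 := by
    rintro (_ | i) (_ | j) <;> simp [withOne, htr0, horth]
  let M : Matrix (Option (Fin (d ^ 2 - 1))) (Fin d × Fin d) ℂ :=
    Matrix.of fun o p => withOne lam o p.1 p.2
  let N : Matrix (Fin d × Fin d) (Option (Fin (d ^ 2 - 1))) ℂ :=
    Matrix.of fun p o => withOne lam o p.2 p.1 / d
  have hMN : M * N = 1 := by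
    ext o o'
    have h := htr o o'
    simp only [Matrix.trace, Matrix.diag, Matrix.mul_apply] at h
    simp only [M, N, Matrix.mul_apply, Matrix.of_apply, Fintype.sum_prod_type, mul_div_assoc',
      ← Finset.sum_div, h, Matrix.one_apply]
    split_ifs <;> simp [hd0]
  have hcard : Fintype.card (Option (Fin (d ^ 2 - 1))) = Fintype.card (Fin d × Fin d) := by
    have : 0 < d ^ 2 := by positivity
    simp only [Fintype.card_option, Fintype.card_fin, Fintype.card_prod]
    rw [← sq]; omega
  have hNM := congrFun (congrFun ((Matrix.mul_eq_one_comm_of_card_eq _ _ _ hcard).mp hMN) p) q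
  simp only [M, N, Matrix.mul_apply, Matrix.of_apply, Matrix.one_apply, div_mul_eq_mul_div,
    ← Finset.sum_div] at hNM
  rw [div_eq_iff hd0] at hNM
  rw [hNM]
  split_ifs <;> simp

/-- Parseval's identity for an orthogonal Hermitian matrix basis. -/
lemma sum_norm_sq_withOne {lam : Fin (d ^ 2 - 1) → Matrix (Fin d) (Fin d) ℂ} (hd : 2 ≤ d)
    (hherm : ∀ i, (lam i).IsHermitian) (htr0 : ∀ i, (lam i).trace = 0)
    (horth : ∀ i j, (lam i * lam j).trace = if i = j then (d : ℂ) else 0)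
    (g : Fin d × Fin d → ℂ) :
    ∑ o, ‖∑ p, g p * withOne lam o p.2 p.1‖ ^ 2 = d * ∑ p, ‖g p‖ ^ 2 := by
  have hconj : ∀ o x y, (starRingEnd ℂ) (withOne lam o x y) = withOne lam o y x := by
    rintro (_ | i) x y
    · exact Matrix.isHermitian_one.apply y x
    · exact (hherm i).apply y x
  apply Complex.ofReal_injective
  simp only [Complex.ofReal_sum, Complex.ofReal_pow, Complex.ofReal_mul, ← Complex.mul_conj',
    map_sum, map_mul, hconj, Finset.sum_mul_sum, Complex.ofReal_natCast]
  calc _ = ∑ p, ∑ q, ∑ o, (g p * (starRingEnd ℂ) (g q)) *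
          (withOne lam o p.2 p.1 * withOne lam o q.1 q.2) := by
        rw [Finset.sum_comm]
        refine Finset.sum_congr rfl fun p _ => ?_
        rw [Finset.sum_comm]
        refine Finset.sum_congr rfl fun q _ => Finset.sum_congr rfl fun o _ => ?_
        ring
    _ = _ := by
        simp only [← Finset.mul_sum, sum_withOne_mul_withOne hd htr0 horth]
        simp [mul_comm, Finset.mul_sum]

/-- Parseval's identity for the tensor square of an orthogonal Hermitian matrix basis. -/
lemma sum_sum_norm_sq_withOne {lam : Fin (d ^ 2 - 1) → Matrix (Fin d) (Fin d) ℂ} (hd : 2 ≤ d)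
    (hherm : ∀ i, (lam i).IsHermitian) (htr0 : ∀ i, (lam i).trace = 0)
    (horth : ∀ i j, (lam i * lam j).trace = if i = j then (d : ℂ) else 0)
    (g : Fin d × Fin d → Fin d × Fin d → ℂ) :
    ∑ o, ∑ o', ‖∑ p, ∑ q, g p q * withOne lam o p.2 p.1 * withOne lam o' q.2 q.1‖ ^ 2 =
      d ^ 2 * ∑ p, ∑ q, ‖g p q‖ ^ 2 := by
  rw [Finset.sum_comm]
  calc _ = ∑ o', ∑ o, ‖∑ p, (∑ q, g p q * withOne lam o' q.2 q.1) * withOne lam o p.2 p.1‖ ^ 2 := by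
        simp only [Finset.sum_mul, mul_right_comm]
    _ = ∑ o', d * ∑ p, ‖∑ q, g p q * withOne lam o' q.2 q.1‖ ^ 2 :=
        Finset.sum_congr rfl fun o' _ => sum_norm_sq_withOne hd hherm htr0 horth _
    _ = _ := by
        rw [← Finset.mul_sum, Finset.sum_comm]
        simp only [sum_norm_sq_withOne hd hherm htr0 horth, ← Finset.mul_sum]
        ring

lemma sum_sum_prod_transpose {M : Type*} [AddCommMonoid M]
    (f : Fin d → Fin d → Fin d → Fin d → M) :
    ∑ p : Fin d × Fin d, ∑ q : Fin d × Fin d, f p.1 q.1 p.2 q.2 =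
      ∑ p : Fin d × Fin d, ∑ q : Fin d × Fin d, f p.1 p.2 q.1 q.2 := by
  simp only [Fintype.sum_prod_type]
  exact Finset.sum_congr rfl fun x _ => Finset.sum_comm

lemma trace_mul_kron4_left (A B : Matrix (Fin d) (Fin d) ℂ) :
    (ρ * kron4 A B 1 1).trace = ∑ p : Fin d × Fin d, ∑ q : Fin d × Fin d,
      (∑ z : Fin d × Fin d, ρ (p.1, q.1, z) (p.2, q.2, z)) * A p.2 p.1 * B q.2 q.1 := by
  rw [sum_sum_prod_transpose fun x y x' y' =>
    (∑ z : Fin d × Fin d, ρ (x, y, z) (x', y', z)) * A x' x * B y' y]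
  simp only [Finset.sum_mul]
  rw [Finset.sum_congr rfl fun p _ => Finset.sum_comm]
  simp only [Matrix.trace, Matrix.diag, Matrix.mul_apply, kron4, Matrix.of_apply,
    Fintype.sum_prod_type, Matrix.one_apply, mul_ite, mul_one, mul_zero, Finset.sum_ite_eq',
    Finset.mem_univ, if_true, ← mul_assoc]

lemma trace_submatrix_equiv {n : Type*} [Fintype n] (e : Equiv.Perm n) (M : Matrix n n ℂ) :
    (M.submatrix e e).trace = M.trace :=
  Equiv.sum_comp e fun i => M i i

lemma trace_submatrix_mul (e : Equiv.Perm (Fin d × Fin d × Fin d × Fin d))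
    {K L : Matrix (Fin d × Fin d × Fin d × Fin d) (Fin d × Fin d × Fin d × Fin d) ℂ}
    (h : L.submatrix e e = K) :
    (ρ.submatrix e e * K).trace = (ρ * L).trace := by
  rw [← h, Matrix.submatrix_mul_equiv, trace_submatrix_equiv]

/-- Exchange of the first two and the last two parties. -/
def swapPairs (α : Type*) : Equiv.Perm (α × α × α × α) where
  toFun p := (p.2.2.1, p.2.2.2, p.1, p.2.1)
  invFun p := (p.2.2.1, p.2.2.2, p.1, p.2.1)
  left_inv _ := rfl
  right_inv _ := rfl

/-- Exchange of the second and third parties. -/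
def swapMiddle (α : Type*) : Equiv.Perm (α × α × α × α) where
  toFun p := (p.1, p.2.2.1, p.2.1, p.2.2.2)
  invFun p := (p.1, p.2.2.1, p.2.1, p.2.2.2)
  left_inv _ := rfl
  right_inv _ := rfl

/-- Reindexing that turns the party order `A, B, C, D` into `A, D, B, C`. -/
def rotateLast (α : Type*) : Equiv.Perm (α × α × α × α) where
  toFun p := (p.1, p.2.2.1, p.2.2.2, p.2.1)
  invFun p := (p.1, p.2.2.2, p.2.1, p.2.2.1)
  left_inv _ := rfl
  right_inv _ := rfl

lemma trace_swapPairs (A B C D : Matrix (Fin d) (Fin d) ℂ) :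
    (ρ.submatrix (swapPairs _) (swapPairs _) * kron4 A B C D).trace =
      (ρ * kron4 C D A B).trace :=
  trace_submatrix_mul ρ _ <| by
    ext p q
    simp only [kron4, swapPairs, Matrix.submatrix_apply, Matrix.of_apply, Equiv.coe_fn_mk]
    ring

lemma trace_swapMiddle (A B C D : Matrix (Fin d) (Fin d) ℂ) :
    (ρ.submatrix (swapMiddle _) (swapMiddle _) * kron4 A B C D).trace =
      (ρ * kron4 A C B D).trace :=
  trace_submatrix_mul ρ _ <| by
    ext p q
    simp only [kron4, swapMiddle, Matrix.submatrix_apply, Matrix.of_apply, Equiv.coe_fn_mk]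
    ring

lemma trace_rotateLast (A B C D : Matrix (Fin d) (Fin d) ℂ) :
    (ρ.submatrix (rotateLast _) (rotateLast _) * kron4 A B C D).trace =
      (ρ * kron4 A C D B).trace :=
  trace_submatrix_mul ρ _ <| by
    ext p q
    simp only [kron4, rotateLast, Matrix.submatrix_apply, Matrix.of_apply, Equiv.coe_fn_mk]
    ring

lemma kron4_one : kron4 (1 : Matrix (Fin d) (Fin d) ℂ) 1 1 1 = 1 := by
  ext ⟨x, y, z, w⟩ ⟨x', y', z', w'⟩
  simp only [kron4, Matrix.of_apply, Matrix.one_apply, Prod.mk.injEq, ite_and, mul_ite, mul_one,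
    mul_zero]
  split_ifs <;> simp_all

/-- The purity of the marginal on the first two parties in terms of the Bloch vectors and the spin
correlation matrix. -/
lemma RABsq_add_aSq_add_bSq (hd : 2 ≤ d) (hherm : ∀ i, (lam i).IsHermitian)
    (htr0 : ∀ i, (lam i).trace = 0)
    (horth : ∀ i j, (lam i * lam j).trace = if i = j then (d : ℂ) else 0) (htr1 : ρ.trace = 1) :
    RABsq lam ρ + aSq lam ρ + bSq lam ρ + 1 =
      d ^ 2 * ∑ p : Fin d × Fin d, ∑ q : Fin d × Fin d,
        ‖∑ z : Fin d × Fin d, ρ (p.1, q.1, z) (p.2, q.2, z)‖ ^ 2 := by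
  rw [← sum_sum_norm_sq_withOne hd hherm htr0 horth]
  simp only [← trace_mul_kron4_left, Fintype.sum_option, withOne, Option.elim, kron4_one, mul_one,
    htr1, Finset.sum_add_distrib, RABsq, aSq, bSq, norm_one, one_pow]
  ring

lemma RABsq_sub_RCDsq (hd : 2 ≤ d) (hherm : ∀ i, (lam i).IsHermitian)
    (htr0 : ∀ i, (lam i).trace = 0)
    (horth : ∀ i j, (lam i * lam j).trace = if i = j then (d : ℂ) else 0)
    (hH : ρ.IsHermitian) (htr1 : ρ.trace = 1) (hpure : ρ * ρ = ρ) :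
    RABsq lam ρ - RCDsq lam ρ = -(aSq lam ρ + bSq lam ρ) + cSq lam ρ + dSq lam ρ := by
  have hAB := RABsq_add_aSq_add_bSq lam ρ hd hherm htr0 horth htr1
  have hCD := RABsq_add_aSq_add_bSq lam (ρ.submatrix (swapPairs _) (swapPairs _)) hd hherm htr0
    horth (by rw [trace_submatrix_equiv, htr1])
  simp only [RABsq, aSq, bSq, trace_swapPairs] at hCD
  change RCDsq lam ρ + cSq lam ρ + dSq lam ρ + 1 = _ at hCD
  let e := Equiv.prodAssoc (Fin d) (Fin d) (Fin d × Fin d)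
  have hpur := marginal_purity_eq (P := ρ.submatrix e e) (hH.submatrix e)
    (by rw [← htr1]; exact Equiv.sum_comp e fun i => ρ i i)
    (by rw [Matrix.submatrix_mul_equiv, hpure])
  have key : ∑ p : Fin d × Fin d, ∑ q : Fin d × Fin d,
        ‖∑ z : Fin d × Fin d, ρ (p.1, q.1, z) (p.2, q.2, z)‖ ^ 2 =
      ∑ p : Fin d × Fin d, ∑ q : Fin d × Fin d,
        ‖∑ z : Fin d × Fin d, ρ.submatrix (swapPairs _) (swapPairs _)
          (p.1, q.1, z) (p.2, q.2, z)‖ ^ 2 := by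
    rw [sum_sum_prod_transpose fun x y x' y' => ‖∑ z : Fin d × Fin d, ρ (x, y, z) (x', y', z)‖ ^ 2,
      sum_sum_prod_transpose fun x y x' y' => ‖∑ z : Fin d × Fin d,
        ρ.submatrix (swapPairs _) (swapPairs _) (x, y, z) (x', y', z)‖ ^ 2]
    exact hpur
  rw [key] at hAB
  linarith

/-- For a pure quadripartite qudit state, the differences of isotropic strengths of
complementary pairs (Eq. (15) of the paper). -/
theorem complementary_pair_strength_differences (d : ℕ) (hd : 2 ≤ d)
    (lam : Fin (d ^ 2 - 1) → Matrix (Fin d) (Fin d) ℂ)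
    (hherm : ∀ i, (lam i).IsHermitian)
    (htr0 : ∀ i, (lam i).trace = 0)
    (horth : ∀ i j, (lam i * lam j).trace = if i = j then (d : ℂ) else 0)
    (ρ : Matrix (Fin d × Fin d × Fin d × Fin d) (Fin d × Fin d × Fin d × Fin d) ℂ)
    (hpsd : ρ.PosSemidef) (htr1 : ρ.trace = 1) (hpure : ρ * ρ = ρ) :
    sAB lam ρ - sCD lam ρ =
        (-(aSq lam ρ + bSq lam ρ) + cSq lam ρ + dSq lam ρ) / ((d : ℝ) ^ 2 - 1) ∧
    sAC lam ρ - sBD lam ρ =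
        (-(aSq lam ρ + cSq lam ρ) + bSq lam ρ + dSq lam ρ) / ((d : ℝ) ^ 2 - 1) ∧
    sAD lam ρ - sBC lam ρ =
        (-(aSq lam ρ + dSq lam ρ) + bSq lam ρ + cSq lam ρ) / ((d : ℝ) ^ 2 - 1) := by
  have hperm : ∀ e : Equiv.Perm (Fin d × Fin d × Fin d × Fin d), _ := fun e =>
    RABsq_sub_RCDsq lam (ρ.submatrix e e) hd hherm htr0 horth (hpsd.isHermitian.submatrix e)
      (by rw [trace_submatrix_equiv, htr1]) (by rw [Matrix.submatrix_mul_equiv, hpure])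
  refine ⟨?_, ?_, ?_⟩
  · rw [sAB, sCD, ← sub_div,
      RABsq_sub_RCDsq lam ρ hd hherm htr0 horth hpsd.isHermitian htr1 hpure]
  · have h := hperm (swapMiddle _)
    simp only [RABsq, RCDsq, aSq, bSq, cSq, dSq, trace_swapMiddle] at h
    rw [sAC, sBD, ← sub_div]
    exact congrArg (· / ((d : ℝ) ^ 2 - 1)) h
  · have h := hperm (rotateLast _)
    simp only [RABsq, RCDsq, aSq, bSq, cSq, dSq, trace_rotateLast] at h
    rw [sAD, sBC, ← sub_div]
    exact congrArg (· / ((d : ℝ) ^ 2 - 1)) h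

end SpinCorr4
end
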